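/- arXiv:1505.01523 — 2 statements merged into one kernel-verified Lean document; each statement's English description precedes it below -/
import Mathlib

section
/- Double tabulation gives high independence (Theorem 7): consider for each power of two Σ parameters c = c(Σ) and d = d(Σ) with c = Σ^{o(1)} and (c+d)^c = Σ^{o(1)}, and let k = k(Σ) = Σ^{1/(5c)}. Let h_0 : Σ^c → Σ^d be a random simple tabulation function. Then the probability that h_0 fails to be k-unique is o(Σ^{2−d/(2c)}) as Σ → ∞. Consequently, on the event that h_0 is k-unique, if h_1 : Σ^d → [2^r] is an independent random simple tabulation function, then h_1 ∘ h_0 is k-independent. -/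
open scoped Classical
open Finset Asymptotics

/-- Bit strings of length `n`, identified with `(𝔽₂)^n`; bitwise XOR is
coordinatewise addition in `ZMod 2`.  This models the set `[2^n]`.
The alphabet is `Σ = Bits s`, of size `2^s`. -/
abbrev Bits (n : ℕ) : Type := Fin n → ZMod 2

/-- Probability of an event under the uniform distribution on a finite sample space. -/
noncomputable def Pr {Ω : Type*} [Fintype Ω] (E : Ω → Prop) : ℝ :=
  ((Finset.univ.filter E).card : ℝ) / (Fintype.card Ω : ℝ)

/-- Simple tabulation hashing with `c` random character tables. -/
def simpleTab {c : ℕ} {A R : Type*} [AddCommMonoid R] (T : Fin c → A → R) (x : Fin c → A) : R :=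
  ∑ i, T i (x i)

/-- `f : U → Σ^d` is `k`-unique if every nonempty key set `Y` of size at most `k` has a
unique output character: some `x ∈ Y` and position `j` with `f(y)_j ≠ f(x)_j` for all
`y ∈ Y \ {x}`. -/
def KUnique {U : Type*} {s d : ℕ} (f : U → Fin d → Bits s) (k : ℕ) : Prop :=
  ∀ Y : Finset U, Y.Nonempty → Y.card ≤ k →
    ∃ x ∈ Y, ∃ j : Fin d, ∀ y ∈ Y, y ≠ x → f y j ≠ f x j

theorem fiber_pr {G H : Type*} [AddCommGroup G] [AddCommGroup H] [Fintype G] [Fintype H]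
    (φ : G →+ H) (hφ : Function.Surjective φ) (a : H) :
    Pr (fun g : G => φ g = a) = 1 / (Fintype.card H : ℝ) := by
  have h1 : ∀ b : H, (univ.filter (fun g => φ g = b)).card
      = (univ.filter (fun g => φ g = a)).card := by
    intro b
    exact AddMonoidHom.card_fiber_eq_of_mem_range φ (hφ b) (hφ a)
  have h2 : Fintype.card G = ∑ b : H, (univ.filter (fun g => φ g = b)).card := by
    rw [← Finset.card_univ]
    exact Finset.card_eq_sum_card_fiberwise (fun x _ => by simp)
  rw [Finset.sum_congr rfl (fun b _ => h1 b)] at h2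
  simp only [sum_const, card_univ, smul_eq_mul] at h2
  unfold Pr
  have hG : (0:ℝ) < Fintype.card G := by exact_mod_cast Fintype.card_pos
  have hH : (0:ℝ) < Fintype.card H := by exact_mod_cast Fintype.card_pos
  rw [div_eq_div_iff hG.ne' hH.ne', h2]
  push_cast; ring

theorem simpleTab_add {c : ℕ} {A R : Type*} [AddCommMonoid R] (T T' : Fin c → A → R)
    (x : Fin c → A) : simpleTab (T + T') x = simpleTab T x + simpleTab T' x := by
  simp [simpleTab, Finset.sum_add_distrib]

theorem simpleTab_single {c : ℕ} {A R : Type*} [AddCommMonoid R] (j : Fin c) (b : A) (v : R)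
    (x : Fin c → A) :
    simpleTab (fun i a => if i = j ∧ a = b then v else 0) x = if x j = b then v else 0 := by
  unfold simpleTab
  rw [Finset.sum_eq_single j]
  · simp
  · intro i _ hi; simp [hi]
  · simp

theorem peel_surj {U A R : Type*} [AddCommGroup R] {d : ℕ} (f : U → Fin d → A)
    (n : ℕ) : ∀ (Y : Finset U), Y.card = n →
    (∀ Y' ⊆ Y, Y'.Nonempty → ∃ x ∈ Y', ∃ j : Fin d, ∀ y ∈ Y', y ≠ x → f y j ≠ f x j) →
    ∀ a : U → R, ∃ T : Fin d → A → R, ∀ x ∈ Y, simpleTab T (f x) = a x := by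
  induction n with
  | zero =>
    intro Y hY _ a
    rw [Finset.card_eq_zero] at hY
    exact ⟨0, by simp [hY]⟩
  | succ n ih =>
    intro Y hY hu a
    obtain ⟨x, hx, j, hj⟩ := hu Y (subset_refl _) (by rw [← card_pos]; omega)
    obtain ⟨T, hT⟩ := ih (Y.erase x) (by rw [card_erase_of_mem hx]; omega)
      (fun Y' h => hu Y' (h.trans (erase_subset _ _))) a
    refine ⟨T + fun i b => if i = j ∧ b = f x j then a x - simpleTab T (f x) else 0, ?_⟩
    intro y hy
    rw [simpleTab_add, simpleTab_single]
    by_cases hyx : y = x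
    · subst hyx; simp
    · rw [if_neg (hj y hy hyx), add_zero]
      exact hT y (mem_erase.2 ⟨hyx, hy⟩)

def tabHom {ι A R : Type*} [AddCommGroup R] {d : ℕ} (g : ι → Fin d → A) :
    (Fin d → A → R) →+ (ι → R) where
  toFun T := fun i => simpleTab T (g i)
  map_zero' := by ext i; simp [simpleTab]
  map_add' T T' := by ext i; simp [simpleTab_add]

theorem indep_part {U : Type*} {s d r k : ℕ} (f : U → Fin d → Bits s)
    (hf : KUnique f k) (x : Fin k → U) (hx : Function.Injective x) (a : Fin k → Bits r) :
    Pr (fun T₁ : Fin d → Bits s → Bits r => ∀ i, simpleTab T₁ (f (x i)) = a i)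
      = (1 / 2 ^ r) ^ k := by
  have hs : Function.Surjective (tabHom (R := Bits r) (fun i => f (x i))) := by
    intro b
    obtain ⟨T, hT⟩ := peel_surj (R := Bits r) f _ (univ.image x) rfl
      (fun Y' hY' hn => hf Y' hn ((card_le_card hY').trans (card_image_le.trans (by simp))))
      (fun u => if h : ∃ i, x i = u then b h.choose else 0)
    refine ⟨T, ?_⟩
    ext1 i
    have := hT (x i) (mem_image_of_mem _ (mem_univ _))
    have h : ∃ i', x i' = x i := ⟨i, rfl⟩
    rw [dif_pos h, hx h.choose_spec] at this
    exact this
  have := fiber_pr _ hs a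
  have hE : (fun T₁ : Fin d → Bits s → Bits r => ∀ i, simpleTab T₁ (f (x i)) = a i)
      = fun g => tabHom (fun i => f (x i)) g = a := by
    funext T₁
    exact propext ⟨fun h => funext h, fun h i => congrFun h i⟩
  rw [hE, this]
  simp [Bits, ZMod.card]

theorem unif_part {U : Type*} {s d r : ℕ} (hd : 1 ≤ d) (f : U → Fin d → Bits s)
    (x : U) (a : Bits r) :
    Pr (fun T₁ : Fin d → Bits s → Bits r => simpleTab T₁ (f x) = a) = 1 / 2 ^ r := by
  have h1 : KUnique f 1 := by
    intro Y hY hc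
    obtain ⟨z, rfl⟩ := Finset.card_eq_one.1 (le_antisymm hc (card_pos.2 hY))
    exact ⟨z, by simp, ⟨0, hd⟩, by simp⟩
  have := indep_part f h1 (fun _ => x) (fun i j _ => Subsingleton.elim _ _) (fun _ => a)
  simpa using this

/-- the solution set of a triangular system is small -/
theorem tri_count {s c d m e : ℕ} (α : Fin m → Fin c × Bits s) (hα : Function.Injective α)
    (Z : Finset (Fin d × Fin m)) (v : Z → (Fin e → Fin m))
    (h1 : ∀ z, z.1.2 ∈ univ.image (v z)) (h2 : ∀ z i, v z i ≤ z.1.2) :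
    (univ.filter (fun T : Fin c → Bits s → (Fin d → Bits s) =>
      ∀ z : Z, ∑ l ∈ univ.image (v z), T (α l).1 (α l).2 z.1.1 = 0)).card * (2 ^ s) ^ Z.card
    ≤ Fintype.card (Fin c → Bits s → (Fin d → Bits s)) := by
  set K := univ.filter (fun T : Fin c → Bits s → (Fin d → Bits s) =>
      ∀ z : Z, ∑ l ∈ univ.image (v z), T (α l).1 (α l).2 z.1.1 = 0) with hK
  have hcard : K.card * (2 ^ s) ^ Z.card = (K ×ˢ (univ : Finset (Z → Bits s))).card := by
    rw [card_product]; simp [Bits, ZMod.card]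
  rw [hcard, ← Finset.card_univ]
  let ext : (Z → Bits s) → Fin d → Fin m → Bits s :=
    fun g j l => if h : (j, l) ∈ Z then g ⟨(j, l), h⟩ else 0
  let D : (Z → Bits s) → (Fin c → Bits s → (Fin d → Bits s)) :=
    fun g i a j => if h : ∃ l, α l = (i, a) then ext g j h.choose else 0
  have hD : ∀ g l j, D g (α l).1 (α l).2 j = ext g j l := by
    intro g l j
    have h : ∃ l', α l' = ((α l).1, (α l).2) := ⟨l, rfl⟩
    simp only [D]
    rw [dif_pos h]
    congr 1
    exact hα h.choose_spec
  apply Finset.card_le_card_of_injOn (fun p => p.1 + D p.2) (fun _ _ => mem_coe.2 (mem_univ _))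
  rintro ⟨T, g⟩ hT ⟨T', g'⟩ hT' heq
  simp only [coe_product, Set.mem_prod, mem_coe, hK, mem_filter, mem_univ, true_and,
    and_true] at hT hT'
  simp only at heq
  have key : ∀ z : Z, ∑ l ∈ univ.image (v z), (ext g z.1.1 l - ext g' z.1.1 l) = 0 := by
    intro z
    have e1 : ∀ l, ext g z.1.1 l - ext g' z.1.1 l
        = T' (α l).1 (α l).2 z.1.1 - T (α l).1 (α l).2 z.1.1 := by
      intro l
      have := congrFun (congrFun (congrFun heq (α l).1) (α l).2) z.1.1
      simp only [Pi.add_apply, hD] at this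
      rw [sub_eq_sub_iff_add_eq_add, add_comm, this, add_comm]
    simp only [e1]
    rw [Finset.sum_sub_distrib, hT, hT', sub_zero]
  have main : ∀ n : ℕ, ∀ l : Fin m, l.1 = n → ∀ j, ext g j l - ext g' j l = 0 := by
    intro n
    induction n using Nat.strong_induction_on with
    | _ n ih =>
      intro l hl j
      by_cases hz : (j, l) ∈ Z
      · have := key ⟨(j, l), hz⟩
        rw [Finset.sum_eq_single_of_mem l (h1 ⟨(j, l), hz⟩)] at this
        · exact this
        · intro l' hl' hne
          obtain ⟨i, _, rfl⟩ := mem_image.1 hl'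
          have hle : v ⟨(j, l), hz⟩ i ≤ l := h2 ⟨(j, l), hz⟩ i
          have hlt := lt_of_le_of_ne hle hne
          exact ih _ (by rw [← hl]; exact hlt) _ rfl j
      · simp [ext, hz]
  have hg : g = g' := by
    funext z
    have := main _ z.1.2 rfl z.1.1
    simp only [ext, Prod.mk.eta, z.2, dif_pos] at this
    exact sub_eq_zero.1 this
  subst hg
  rw [Prod.mk.injEq]
  exact ⟨add_right_cancel heq, rfl⟩

theorem abel_aux (n w : ℕ → ℤ) (hn : ∀ i, n (i+1) ≤ n i)
    (M : ℕ) (h : ∀ m, 1 ≤ m → m ≤ M + 1 → ∑ l ∈ range m, w l ≤ -1) :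
    ∑ l ∈ range (M+1), n l * w l ≤ n M * (∑ l ∈ range (M+1), w l + 1) - n 0 := by
  induction M with
  | zero => simp; linarith
  | succ M ih =>
    have h' := ih (fun m a b => h m a (by omega))
    rw [sum_range_succ, sum_range_succ w]
    have := h (M+1) (by omega) (by omega)
    nlinarith [hn M]

theorem sumkey {s c M : ℕ} {R : Type*} [AddCommMonoid R] (β : Fin M → Fin c × Bits s)
    (hβ : Function.Injective β) (x : Fin c → Bits s) (hx : ∀ i, ∃ l, β l = (i, x i))
    (t : Fin c × Bits s → R) :
    ∑ l, (if x (β l).1 = (β l).2 then t (β l) else 0) = ∑ i, t (i, x i) := by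
  have h1 : ∀ i, t (i, x i) = ∑ l, if β l = (i, x i) then t (β l) else 0 := by
    intro i
    obtain ⟨l, hl⟩ := hx i
    rw [Finset.sum_eq_single l]
    · rw [if_pos hl, hl]
    · intro l' _ hne
      rw [if_neg]
      intro h
      exact hne (hβ (h.trans hl.symm))
    · simp
  rw [Finset.sum_congr rfl (fun i _ => h1 i), Finset.sum_comm]
  refine Finset.sum_congr rfl (fun l _ => ?_)
  rw [Finset.sum_eq_single (β l).1]
  · by_cases h : x (β l).1 = (β l).2
    · rw [if_pos h, if_pos (by rw [h])]
    · rw [if_neg h, if_neg]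
      intro h'
      exact h (congrArg Prod.snd h').symm
  · intro i _ hne
    rw [if_neg]
    intro h'
    exact hne (congrArg Prod.fst h').symm
  · simp

/-- sorted enumeration of the input characters -/
theorem exists_order {s c : ℕ} (Y : Finset (Fin c → Bits s)) :
    ∃ M, M ≤ c * Y.card ∧ ∃ β : Fin M → Fin c × Bits s, Function.Injective β ∧
      (∀ x ∈ Y, ∀ i, ∃ l, β l = (i, x i)) ∧
      (∀ l, ∃ x ∈ Y, x (β l).1 = (β l).2) ∧
      (∀ l l', l ≤ l' → (Y.filter (fun x => x (β l').1 = (β l').2)).card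
        ≤ (Y.filter (fun x => x (β l).1 = (β l).2)).card) := by
  set A : Finset (Fin c × Bits s) := Y.biUnion (fun x => univ.image (fun i => (i, x i))) with hA
  have hM : A.card ≤ c * Y.card := by
    rw [mul_comm]
    refine Finset.card_biUnion_le_card_mul _ _ _ (fun x _ => ?_)
    exact card_image_le.trans (by simp)
  let e := A.equivFin.symm
  let nn : Fin A.card → ℤ := fun l => -((Y.filter (fun x => x (e l).1.1 = (e l).1.2)).card : ℤ)
  let σ := Tuple.sort nn
  refine ⟨A.card, hM, fun l => (e (σ l)).1, ?_, ?_, ?_, ?_⟩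
  · intro l l' h
    exact σ.injective (e.injective (Subtype.ext h))
  · intro x hx i
    have : (i, x i) ∈ A := by
      rw [hA, mem_biUnion]
      exact ⟨x, hx, mem_image_of_mem _ (mem_univ _)⟩
    refine ⟨σ.symm (e.symm ⟨_, this⟩), ?_⟩
    simp
  · intro l
    have := (e (σ l)).2
    obtain ⟨x, hx, h⟩ := mem_biUnion.1 this
    obtain ⟨i, _, hi⟩ := mem_image.1 h
    refine ⟨x, hx, ?_⟩
    show x (e (σ l)).1.1 = (e (σ l)).1.2
    rw [← hi]
  · intro l l' hl
    have := Tuple.monotone_sort nn hl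
    simp only [nn, Function.comp, neg_le_neg_iff] at this
    exact_mod_cast this

/-- every colliding class is hit by the leading characters -/
theorem half_cover {s c M : ℕ} {V : Type*} (β : Fin M → Fin c × Bits s)
    (Y : Finset (Fin c → Bits s)) (f : (Fin c → Bits s) → V)
    (hbad : ∀ x ∈ Y, ∃ y ∈ Y, y ≠ x ∧ f y = f x)
    (L : Finset (Fin M))
    (hL : ∀ x ∈ Y, ∀ y ∈ Y, x ≠ y → f x = f y →
      ∃ l ∈ L, x (β l).1 = (β l).2 ∨ y (β l).1 = (β l).2) :
    Y.card ≤ 2 * ∑ l ∈ L, (Y.filter (fun x => x (β l).1 = (β l).2)).card := by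
  set P : (Fin c → Bits s) → Prop := fun x => ∃ l ∈ L, x (β l).1 = (β l).2 with hP
  have hsplit := Finset.card_filter_add_card_filter_not (s := Y) P
  have h1 : (Y.filter P).card ≤ ∑ l ∈ L, (Y.filter (fun x => x (β l).1 = (β l).2)).card := by
    refine le_trans (card_le_card ?_) card_biUnion_le
    intro x hx
    obtain ⟨hx, l, hl, h⟩ := mem_filter.1 hx
    exact mem_biUnion.2 ⟨l, hl, mem_filter.2 ⟨hx, h⟩⟩
  choose! p hpY hpne hpf using hbad
  have h2 : (Y.filter (fun x => ¬ P x)).card ≤ (Y.filter P).card := by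
    apply Finset.card_le_card_of_injOn p
    · intro x hx
      obtain ⟨hx, hn⟩ := mem_filter.1 (mem_coe.1 hx)
      refine mem_coe.2 (mem_filter.2 ⟨hpY x hx, ?_⟩)
      obtain ⟨l, hl, h | h⟩ := hL x hx (p x) (hpY x hx) (hpne x hx).symm (hpf x hx).symm
      · exact absurd ⟨l, hl, h⟩ hn
      · exact ⟨l, hl, h⟩
    · intro x hx x' hx' heq
      obtain ⟨hx, hn⟩ := mem_filter.1 (mem_coe.1 hx)
      obtain ⟨hx', hn'⟩ := mem_filter.1 (mem_coe.1 hx')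
      by_contra hne
      have : f x = f x' := by rw [← hpf x hx, ← hpf x' hx', heq]
      obtain ⟨l, hl, h | h⟩ := hL x hx x' hx' hne this
      · exact hn ⟨l, hl, h⟩
      · exact hn' ⟨l, hl, h⟩
  omega

/-- averaging: some prefix has many leading characters -/
theorem exists_prefix {M : ℕ} (n b : Fin M → ℕ) (c d N : ℕ) (hM : 0 < M)
    (hn : ∀ l l', l ≤ l' → n l' ≤ n l) (hpos : ∀ l, 0 < n l)
    (h1 : ∑ l, n l = c * N) (h2 : d * N ≤ 2 * ∑ l, n l * b l) :
    ∃ m, 1 ≤ m ∧ ∃ hm : m ≤ M, d * m ≤ 2 * c * ∑ l : Fin m, b (Fin.castLE hm l) := by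
  by_contra hcon
  push Not at hcon
  obtain ⟨M, rfl⟩ : ∃ M', M = M' + 1 := ⟨M - 1, by omega⟩
  let n' : ℕ → ℤ := fun i => if h : i < M + 1 then (n ⟨i, h⟩ : ℤ) else 0
  let b' : ℕ → ℤ := fun i => if h : i < M + 1 then (b ⟨i, h⟩ : ℤ) else 0
  let w : ℕ → ℤ := fun i => 2 * c * b' i - d
  have hn' : ∀ i, n' (i+1) ≤ n' i := by
    intro i
    simp only [n']
    split_ifs with h h'
    · exact_mod_cast hn _ _ (by simp [Fin.le_def])
    · omega
    · positivity
    · rfl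
  have hw : ∀ m, 1 ≤ m → m ≤ M + 1 → ∑ l ∈ range m, w l ≤ -1 := by
    intro m hm1 hm
    have := hcon m hm1 hm
    have e : ∑ l ∈ range m, w l
        = 2 * c * ((∑ l : Fin m, b (Fin.castLE hm l) : ℕ) : ℤ) - d * m := by
      rw [← Fin.sum_univ_eq_sum_range]
      simp only [w]
      rw [Finset.sum_sub_distrib, ← Finset.mul_sum]
      push_cast
      congr 1
      · congr 1
        refine Finset.sum_congr rfl (fun l _ => ?_)
        simp only [b']
        rw [dif_pos (by omega)]
        rfl
      · simp [mul_comm]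
    rw [e]
    have : (2 * c * (∑ l : Fin m, b (Fin.castLE hm l) : ℕ) : ℤ) < (d * m : ℕ) := by exact_mod_cast this
    push_cast at this ⊢
    linarith
  have hA := abel_aux n' w hn' M hw
  have e2 : ∑ l ∈ range (M+1), n' l * w l
      = 2 * c * ((∑ l, n l * b l : ℕ) : ℤ) - d * ((∑ l, n l : ℕ) : ℤ) := by
    rw [← Fin.sum_univ_eq_sum_range (fun l => n' l * w l)]
    push_cast
    rw [Finset.mul_sum, Finset.mul_sum, ← Finset.sum_sub_distrib]
    refine Finset.sum_congr rfl (fun l _ => ?_)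
    simp only [n', w, b', l.2, dif_pos]
    ring
  have h0 : 0 < n' 0 := by
    simp only [n']
    rw [dif_pos (by omega)]
    exact_mod_cast hpos _
  have h3 : 0 ≤ n' M := by
    simp only [n']; split_ifs <;> positivity
  have h4 := hw (M+1) (by omega) le_rfl
  have h5 : n' M * (∑ l ∈ range (M+1), w l + 1) ≤ 0 :=
    mul_nonpos_of_nonneg_of_nonpos h3 (by linarith)
  have h6 : (0:ℤ) ≤ ∑ l ∈ range (M+1), n' l * w l := by
    rw [e2, h1]
    have : c * (d * N) ≤ c * (2 * ∑ l, n l * b l) := Nat.mul_le_mul_left _ h2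
    zify at this
    push_cast
    nlinarith
  linarith

theorem exists_surj {e m : ℕ} (A : Finset (Fin m)) (hA : A.Nonempty) (h : A.card ≤ e) :
    ∃ g : Fin e → Fin m, univ.image g = A := by
  have : Nonempty A := hA.to_subtype
  obtain ⟨φ⟩ : Nonempty (A ↪ Fin e) := by
    rw [Function.Embedding.nonempty_iff_card_le]; simpa using h
  refine ⟨fun i => (Function.invFun φ i).1, ?_⟩
  ext a
  simp only [mem_image, mem_univ, true_and]
  constructor
  · rintro ⟨i, rfl⟩; exact Subtype.prop _
  · intro ha
    exact ⟨φ ⟨a, ha⟩, by rw [Function.leftInverse_invFun φ.injective]⟩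

theorem bits_add_self {s : ℕ} (a : Bits s) : a + a = 0 := by
  funext i
  exact CharTwo.add_self_eq_zero (a i)

theorem witness {s c d k : ℕ} (hc : 1 ≤ c) (hd : 1 ≤ d) (T : Fin c → Bits s → (Fin d → Bits s))
    (h : ¬ KUnique (fun x : Fin c → Bits s => simpleTab T x) k) :
    ∃ m ∈ Icc 2 (c * k), ∃ α : Fin m → Fin c × Bits s, Function.Injective α ∧
      ∃ Z : Finset (Fin d × Fin m), d * m ≤ 2 * c * Z.card ∧
      ∃ v : Z → (Fin (2 * c) → Fin m),
        ((∀ z, z.1.2 ∈ univ.image (v z)) ∧ (∀ z i, v z i ≤ z.1.2)) ∧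
        ∀ z : Z, ∑ l ∈ univ.image (v z), T (α l).1 (α l).2 z.1.1 = 0 := by
  unfold KUnique at h
  push Not at h
  obtain ⟨Y, hYne, hYk, hbad⟩ := h
  obtain ⟨M, hM, β, hβ, hcov, hocc, hmono⟩ := exists_order Y
  set n : Fin M → ℕ := fun l => (Y.filter (fun x => x (β l).1 = (β l).2)).card with hn
  let vs : (Fin c → Bits s) → (Fin c → Bits s) → Finset (Fin M) := fun x y =>
    univ.filter (fun l => ¬ (x (β l).1 = (β l).2 ↔ y (β l).1 = (β l).2))
  have two : ∀ x ∈ Y, ∀ y ∈ Y, x ≠ y → ∃ l ∈ vs x y, ∃ l' ∈ vs x y, l ≠ l' := by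
    intro x hx y hy hxy
    obtain ⟨i, hi⟩ := Function.ne_iff.1 hxy
    obtain ⟨l, hl⟩ := hcov x hx i
    obtain ⟨l', hl'⟩ := hcov y hy i
    refine ⟨l, ?_, l', ?_, ?_⟩
    · simp only [vs, mem_filter, mem_univ, true_and, hl]
      intro h; exact hi (h.1 trivial).symm
    · simp only [vs, mem_filter, mem_univ, true_and, hl']
      intro h; exact hi (h.2 trivial)
    · rintro rfl
      rw [hl] at hl'
      exact hi (congrArg Prod.snd hl')
  have vcard : ∀ x y, (vs x y).card ≤ 2 * c := by
    intro x y
    have : ((vs x y).image β).card ≤ 2 * c := by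
      refine (card_le_card (t := univ.image (fun i => (i, x i)) ∪ univ.image (fun i => (i, y i)))
        ?_).trans ((card_union_le _ _).trans ?_)
      · intro a ha
        obtain ⟨l, hl, rfl⟩ := mem_image.1 ha
        simp only [vs, mem_filter, mem_univ, true_and] at hl
        rw [mem_union, mem_image, mem_image]
        by_cases h1 : x (β l).1 = (β l).2
        · exact Or.inl ⟨_, mem_univ _, by rw [h1]⟩
        · have h2 : y (β l).1 = (β l).2 := by tauto
          exact Or.inr ⟨_, mem_univ _, by rw [h2]⟩
      · have a1 : (univ.image (fun i => (i, x i))).card ≤ c := card_image_le.trans (by simp)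
        have a2 : (univ.image (fun i => (i, y i))).card ≤ c := card_image_le.trans (by simp)
        omega
    rwa [card_image_of_injective _ hβ] at this
  have veq : ∀ x ∈ Y, ∀ y ∈ Y, ∀ j, simpleTab T x j = simpleTab T y j →
      ∑ l ∈ vs x y, T (β l).1 (β l).2 j = 0 := by
    intro x hx y hy j hxy
    have ex := sumkey β hβ x (hcov x hx) (fun a => T a.1 a.2 j)
    have ey := sumkey β hβ y (hcov y hy) (fun a => T a.1 a.2 j)
    have e1 : ∑ l ∈ vs x y, T (β l).1 (β l).2 j
        = ∑ i, T i (x i) j + ∑ i, T i (y i) j := by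
      simp only at ex ey
      rw [← ex, ← ey, ← Finset.sum_add_distrib]
      simp only [vs]
      rw [Finset.sum_filter]
      refine Finset.sum_congr rfl (fun l _ => ?_)
      by_cases h1 : x (β l).1 = (β l).2 <;> by_cases h2 : y (β l).1 = (β l).2 <;>
        simp [h1, h2, bits_add_self]
    rw [e1]
    simp only [simpleTab, Finset.sum_apply] at hxy
    rw [hxy, bits_add_self]
  let L : Fin d → Finset (Fin M) := fun j => univ.filter (fun l => ∃ x ∈ Y, ∃ y ∈ Y, x ≠ y ∧
    simpleTab T x j = simpleTab T y j ∧ l ∈ vs x y ∧ ∀ l' ∈ vs x y, l' ≤ l)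
  let b : Fin M → ℕ := fun l => (univ.filter (fun j => l ∈ L j)).card
  have hhalf : ∀ j, Y.card ≤ 2 * ∑ l ∈ L j, n l := by
    intro j
    apply half_cover β Y (fun x => simpleTab T x j)
    · intro x hx
      obtain ⟨y, hy, h1, h2⟩ := hbad x hx j
      exact ⟨y, hy, h1, h2⟩
    · intro x hx y hy hxy hf
      obtain ⟨l0, hl0, _⟩ := two x hx y hy hxy
      have hne : (vs x y).Nonempty := ⟨l0, hl0⟩
      have hmem := Finset.max'_mem _ hne
      refine ⟨(vs x y).max' hne, ?_, ?_⟩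
      · simp only [L, mem_filter, mem_univ, true_and]
        exact ⟨x, hx, y, hy, hxy, hf, hmem, fun l' hl' => Finset.le_max' _ _ hl'⟩
      · have := (mem_filter.1 hmem).2
        tauto
  have hsum1 : ∑ l, n l = c * Y.card := by
    simp only [hn, card_filter]
    rw [Finset.sum_comm]
    have : ∀ x ∈ Y, ∑ l, (if x (β l).1 = (β l).2 then 1 else 0) = c := by
      intro x hx
      have := sumkey β hβ x (hcov x hx) (fun _ => 1)
      rw [this]; simp
    rw [Finset.sum_congr rfl this]
    simp [mul_comm]
  have hsum2 : d * Y.card ≤ 2 * ∑ l, n l * b l := by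
    have e : ∑ l, n l * b l = ∑ j, ∑ l ∈ L j, n l := by
      have : ∀ j, ∑ l ∈ L j, n l = ∑ l, if l ∈ L j then n l else 0 := by
        intro j; rw [Finset.sum_ite_mem, Finset.univ_inter]
      simp only [this]
      rw [Finset.sum_comm]
      refine Finset.sum_congr rfl (fun l _ => ?_)
      rw [← Finset.sum_filter]
      simp [b, mul_comm]
    rw [e, Finset.mul_sum]
    calc d * Y.card = ∑ j : Fin d, Y.card := by simp
      _ ≤ _ := Finset.sum_le_sum (fun j _ => hhalf j)
  have hMpos : 0 < M := by
    obtain ⟨x, hx⟩ := hYne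
    obtain ⟨l, _⟩ := hcov x hx ⟨0, hc⟩
    exact l.pos
  obtain ⟨m, hm1, hmM, hm⟩ := exists_prefix n b c d Y.card hMpos hmono
    (fun l => by
      obtain ⟨x, hx, h⟩ := hocc l
      exact card_pos.2 ⟨x, mem_filter.2 ⟨hx, h⟩⟩) hsum1 hsum2
  let Z : Finset (Fin d × Fin m) := univ.filter (fun z => Fin.castLE hmM z.2 ∈ L z.1)
  have hZ : Z.card = ∑ l : Fin m, b (Fin.castLE hmM l) := by
    simp only [Z, b, card_filter]
    rw [Fintype.sum_prod_type_right]
  have hZv : ∀ z : Z, ∃ g : Fin (2 * c) → Fin m, z.1.2 ∈ univ.image g ∧ (∀ i, g i ≤ z.1.2) ∧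
      (∃ l l' : Fin m, l ≠ l' ∧ l ≤ z.1.2 ∧ l' ≤ z.1.2) ∧
      ∑ l ∈ univ.image g, T (β (Fin.castLE hmM l)).1 (β (Fin.castLE hmM l)).2 z.1.1 = 0 := by
    rintro ⟨⟨j, l⟩, hz⟩
    simp only [Z, L, mem_filter, mem_univ, true_and] at hz
    obtain ⟨x, hx, y, hy, hxy, hf, hl, hmax⟩ := hz
    let A : Finset (Fin m) := univ.filter (fun l => Fin.castLE hmM l ∈ vs x y)
    have hA : A.map (Fin.castLEEmb hmM) = vs x y := by
      ext a
      simp only [mem_map, A, mem_filter, mem_univ, true_and]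
      constructor
      · rintro ⟨a', h1, rfl⟩; exact h1
      · intro ha
        have := hmax a ha
        have h2 : a.1 < m := lt_of_le_of_lt (Fin.le_def.1 this) l.2
        exact ⟨⟨a.1, h2⟩, ha, rfl⟩
    have hAc : A.card ≤ 2 * c := by
      rw [← card_map (Fin.castLEEmb hmM), hA]; exact vcard x y
    have hlA : l ∈ A := by simp only [A, mem_filter, mem_univ, true_and]; exact hl
    have hAle : ∀ a ∈ A, a ≤ l := by
      intro a ha
      have := hmax _ (mem_filter.1 ha).2
      exact this
    obtain ⟨g, hg⟩ := exists_surj A ⟨l, hlA⟩ hAc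
    refine ⟨g, by rw [hg]; exact hlA, fun i => hAle _ (by rw [← hg]; exact mem_image_of_mem _ (mem_univ _)), ?_, ?_⟩
    · obtain ⟨a, ha, a', ha', hne⟩ := two x hx y hy hxy
      rw [← hA] at ha ha'
      obtain ⟨a, h1, rfl⟩ := mem_map.1 ha
      obtain ⟨a', h1', rfl⟩ := mem_map.1 ha'
      exact ⟨a, a', fun h => hne (by rw [h]), hAle _ h1, hAle _ h1'⟩
    · rw [hg]
      have := veq x hx y hy j hf
      rw [← hA, sum_map] at this
      exact this
  choose v hv1 hv2 hv3 hv4 using hZv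
  refine ⟨m, mem_Icc.2 ⟨?_, ?_⟩, fun l => β (Fin.castLE hmM l), ?_, Z, by rw [hZ]; exact hm,
    v, ⟨hv1, hv2⟩, hv4⟩
  · have : 0 < Z.card := by
      rw [hZ]
      by_contra h0
      have h0 : ∑ l : Fin m, b (Fin.castLE hmM l) = 0 := by omega
      rw [h0] at hm
      have : 0 < d * m := Nat.mul_pos hd hm1
      omega
    obtain ⟨z, hz⟩ := card_pos.1 this
    obtain ⟨l, l', hne, _⟩ := hv3 ⟨z, hz⟩
    by_contra hlt
    apply hne
    ext
    omega
  · exact hmM.trans (hM.trans (Nat.mul_le_mul_left _ hYk))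
  · intro l l' h
    exact Fin.castLE_injective hmM (hβ h)

theorem finite_bound {s c d k : ℕ} (hc : 1 ≤ c) (hd : 1 ≤ d)
    (x : ℝ) (hx : x = ((c * k : ℕ) : ℝ) ^ (2 * c) / 2 ^ s) (hx1 : x ≤ 1) :
    Pr (fun T : Fin c → Bits s → (Fin d → Bits s) =>
          ¬ KUnique (fun x : Fin c → Bits s => simpleTab T x) k) ≤
    ∑ m ∈ Icc 2 (c * k), ((c : ℝ) * 2 ^ s * 2 ^ d * x ^ ((d : ℝ) / (2 * c))) ^ m := by
  have hx0 : 0 ≤ x := by rw [hx]; positivity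
  have hc0 : (0:ℝ) < c := by exact_mod_cast hc
  unfold Pr
  have hΩ : (0:ℝ) < Fintype.card (Fin c → Bits s → (Fin d → Bits s)) := by
    exact_mod_cast Fintype.card_pos
  rw [div_le_iff₀ hΩ]
  set Om : ℝ := (Fintype.card (Fin c → Bits s → (Fin d → Bits s)) : ℝ) with hOm
  let K : (m : ℕ) → (Fin m → Fin c × Bits s) → (Z : Finset (Fin d × Fin m)) →
      (Z → (Fin (2 * c) → Fin m)) → Finset (Fin c → Bits s → (Fin d → Bits s)) :=
    fun m α Z v => univ.filter (fun T =>
      ∀ z : Z, ∑ l ∈ univ.image (v z), T (α l).1 (α l).2 z.1.1 = 0)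
  let VV : (m : ℕ) → (Z : Finset (Fin d × Fin m)) → Finset (Z → (Fin (2 * c) → Fin m)) :=
    fun m Z => univ.filter (fun v => (∀ z, z.1.2 ∈ univ.image (v z)) ∧ (∀ z i, v z i ≤ z.1.2))
  let ZZ : (m : ℕ) → Finset (Finset (Fin d × Fin m)) :=
    fun m => univ.filter (fun Z => d * m ≤ 2 * c * Z.card)
  let AA : (m : ℕ) → Finset (Fin m → Fin c × Bits s) :=
    fun m => univ.filter (fun α => Function.Injective α)
  have hsub : univ.filter (fun T : Fin c → Bits s → (Fin d → Bits s) =>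
          ¬ KUnique (fun x : Fin c → Bits s => simpleTab T x) k) ⊆
      (Icc 2 (c * k)).biUnion fun m => (AA m).biUnion fun α => (ZZ m).biUnion fun Z =>
        (VV m Z).biUnion fun v => K m α Z v := by
    intro T hT
    obtain ⟨m, hm, α, hα, Z, hZ, v, hv, hK⟩ := witness hc hd T (mem_filter.1 hT).2
    refine mem_biUnion.2 ⟨m, hm, mem_biUnion.2 ⟨α, mem_filter.2 ⟨mem_univ _, hα⟩,
      mem_biUnion.2 ⟨Z, mem_filter.2 ⟨mem_univ _, hZ⟩,
      mem_biUnion.2 ⟨v, mem_filter.2 ⟨mem_univ _, hv⟩, mem_filter.2 ⟨mem_univ _, hK⟩⟩⟩⟩⟩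
  have hb1 : ∀ m ∈ Icc 2 (c * k), ∀ α ∈ AA m, ∀ Z ∈ ZZ m,
      (((VV m Z).biUnion fun v => K m α Z v).card : ℝ) ≤
        (x ^ ((d : ℝ) / (2 * c))) ^ m * Om := by
    intro m hm α hα Z hZ
    have hα := (mem_filter.1 hα).2
    have hZ := (mem_filter.1 hZ).2
    have e1 : ∀ v ∈ VV m Z, ((K m α Z v).card : ℝ) ≤ Om / (2 ^ s) ^ Z.card := by
      intro v hv
      obtain ⟨h1, h2⟩ := (mem_filter.1 hv).2
      rw [le_div_iff₀ (by positivity)]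
      have := tri_count α hα Z v h1 h2
      rw [hOm]
      exact_mod_cast this
    calc (((VV m Z).biUnion fun v => K m α Z v).card : ℝ)
        ≤ ∑ v ∈ VV m Z, ((K m α Z v).card : ℝ) := by exact_mod_cast card_biUnion_le
      _ ≤ ∑ v ∈ VV m Z, Om / (2 ^ s) ^ Z.card := Finset.sum_le_sum e1
      _ = (VV m Z).card * (Om / (2 ^ s) ^ Z.card) := by simp
      _ ≤ ((m:ℝ) ^ (2 * c)) ^ Z.card * (Om / (2 ^ s) ^ Z.card) := by
          gcongr
          have : (VV m Z).card ≤ (m ^ (2 * c)) ^ Z.card := by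
            refine (card_le_univ _).trans ?_
            simp
          exact_mod_cast this
      _ ≤ (((c * k : ℕ):ℝ) ^ (2 * c)) ^ Z.card * (Om / (2 ^ s) ^ Z.card) := by
          have : m ≤ c * k := (mem_Icc.1 hm).2
          gcongr
      _ = x ^ Z.card * Om := by rw [hx, div_pow]; ring
      _ ≤ _ := by
          gcongr
          rcases hx0.eq_or_lt with h0 | h0
          · rw [← h0, zero_pow, Real.zero_rpow]
            · positivity
            · have : (0:ℝ) < d := by exact_mod_cast hd
              positivity
            · rintro h
              rw [h] at hZ
              have : 0 < d * m := Nat.mul_pos hd (by have := (mem_Icc.1 hm).1; omega)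
              omega
          · rw [← Real.rpow_natCast, ← Real.rpow_natCast, ← Real.rpow_mul hx0]
            apply Real.rpow_le_rpow_of_exponent_ge h0 hx1
            rw [div_mul_eq_mul_div, div_le_iff₀ (by positivity)]
            have : ((d * m : ℕ) : ℝ) ≤ (2 * c * Z.card : ℕ) := by exact_mod_cast hZ
            push_cast at this
            linarith
  have hb2 : ∀ m ∈ Icc 2 (c * k), ∀ α ∈ AA m,
      (((ZZ m).biUnion fun Z => (VV m Z).biUnion fun v => K m α Z v).card : ℝ) ≤
        (2 ^ d) ^ m * ((x ^ ((d : ℝ) / (2 * c))) ^ m * Om) := by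
    intro m hm α hα
    calc _ ≤ ∑ Z ∈ ZZ m, (((VV m Z).biUnion fun v => K m α Z v).card : ℝ) := by
            exact_mod_cast card_biUnion_le
      _ ≤ ∑ Z ∈ ZZ m, (x ^ ((d : ℝ) / (2 * c))) ^ m * Om := Finset.sum_le_sum (hb1 m hm α hα)
      _ = (ZZ m).card * ((x ^ ((d : ℝ) / (2 * c))) ^ m * Om) := by simp
      _ ≤ _ := by
          have : (ZZ m).card ≤ (2 ^ d) ^ m := by
            refine (card_le_univ _).trans ?_
            simp [pow_mul]
          have : ((ZZ m).card : ℝ) ≤ (2 ^ d) ^ m := by exact_mod_cast this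
          have : 0 ≤ x ^ ((d : ℝ) / (2 * c)) := Real.rpow_nonneg hx0 _
          gcongr
  have hb3 : ∀ m ∈ Icc 2 (c * k),
      (((AA m).biUnion fun α => (ZZ m).biUnion fun Z =>
        (VV m Z).biUnion fun v => K m α Z v).card : ℝ) ≤
        (c * 2 ^ s) ^ m * ((2 ^ d) ^ m * ((x ^ ((d : ℝ) / (2 * c))) ^ m * Om)) := by
    intro m hm
    calc _ ≤ ∑ α ∈ AA m, (((ZZ m).biUnion fun Z =>
              (VV m Z).biUnion fun v => K m α Z v).card : ℝ) := by
            exact_mod_cast card_biUnion_le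
      _ ≤ ∑ α ∈ AA m, (2 ^ d) ^ m * ((x ^ ((d : ℝ) / (2 * c))) ^ m * Om) :=
            Finset.sum_le_sum (hb2 m hm)
      _ = (AA m).card * ((2 ^ d) ^ m * ((x ^ ((d : ℝ) / (2 * c))) ^ m * Om)) := by simp
      _ ≤ _ := by
          have : (AA m).card ≤ (c * 2 ^ s) ^ m := by
            refine (card_le_univ _).trans ?_
            simp [ZMod.card]
          have : ((AA m).card : ℝ) ≤ (c * 2 ^ s) ^ m := by exact_mod_cast this
          have : 0 ≤ x ^ ((d : ℝ) / (2 * c)) := Real.rpow_nonneg hx0 _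
          gcongr
  calc _ ≤ (((Icc 2 (c * k)).biUnion fun m => (AA m).biUnion fun α => (ZZ m).biUnion fun Z =>
        (VV m Z).biUnion fun v => K m α Z v).card : ℝ) := by
          refine le_trans (le_of_eq ?_) (Nat.cast_le.2 (card_le_card hsub))
          congr
    _ ≤ ∑ m ∈ Icc 2 (c * k), (((AA m).biUnion fun α => (ZZ m).biUnion fun Z =>
        (VV m Z).biUnion fun v => K m α Z v).card : ℝ) := by exact_mod_cast card_biUnion_le
    _ ≤ _ := Finset.sum_le_sum hb3
    _ = _ := by
        rw [Finset.sum_mul]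
        refine Finset.sum_congr rfl (fun m _ => ?_)
        rw [mul_pow, mul_pow, mul_pow, mul_pow]
        ring

theorem geom_bound (B : ℝ) (h0 : 0 ≤ B) (h1 : B ≤ 1 / 2) (n : ℕ) :
    ∑ m ∈ Icc 2 n, B ^ m ≤ 2 * B ^ 2 := by
  have key : ∀ n, ∑ m ∈ range n, B ^ m ≤ 2 := by
    intro n
    have := geom_sum_mul_neg B n
    have hp : 0 ≤ B ^ n := pow_nonneg h0 n
    have hs : 0 ≤ ∑ m ∈ range n, B ^ m := Finset.sum_nonneg (fun i _ => pow_nonneg h0 i)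
    nlinarith
  have : ∑ m ∈ Icc 2 n, B ^ m = B ^ 2 * ∑ m ∈ range (n + 1 - 2), B ^ m := by
    rw [Finset.mul_sum, ← Finset.Ico_add_one_right_eq_Icc, Finset.sum_Ico_eq_sum_range]
    exact Finset.sum_congr rfl (fun i _ => by rw [pow_add])
  rw [this]
  nlinarith [key (n + 1 - 2), sq_nonneg B]

theorem Pr_le_one {Ω : Type*} [Fintype Ω] (E : Ω → Prop) : Pr E ≤ 1 := by
  unfold Pr
  apply div_le_one_of_le₀ _ (by positivity)
  exact_mod_cast card_le_univ _

theorem core_bound {s c d k : ℕ} (hc : 1 ≤ c) (hd : 1 ≤ d) (hs : 100 ≤ s)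
    (hk : (k : ℝ) ≤ ((2 : ℝ) ^ s) ^ ((1 : ℝ) / (5 * (c : ℝ))))
    (hG : (((c + d) ^ c : ℕ) : ℝ) ^ 4 ≤ ((2 : ℝ) ^ s) ^ ((1 : ℝ) / 40)) :
    Pr (fun T : Fin c → Bits s → (Fin d → Bits s) =>
          ¬ KUnique (fun x : Fin c → Bits s => simpleTab T x) k) ≤
      (2 * ((2 : ℝ) ^ s) ^ (-(1 : ℝ) / 5)) *
        ((2 : ℝ) ^ s) ^ ((2 : ℝ) - (d : ℝ) / (2 * (c : ℝ))) := by
  set Q : ℝ := (2 : ℝ) ^ s with hQ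
  have hc0 : (0:ℝ) < c := by exact_mod_cast hc
  have hd0 : (0:ℝ) < d := by exact_mod_cast hd
  have hQ1 : 1 ≤ Q := one_le_pow₀ (by norm_num)
  have hQ0 : 0 < Q := by linarith
  have hu0 : 0 < (d : ℝ) / (2 * c) := by positivity
  have h2c : (2:ℝ) ^ d = ((2:ℝ) ^ (2 * c)) ^ ((d : ℝ) / (2 * c)) := by
    rw [← Real.rpow_natCast, ← Real.rpow_natCast, ← Real.rpow_mul (by norm_num)]
    congr 1
    push_cast
    field_simp
  set u : ℝ := (d : ℝ) / (2 * c) with hu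
  by_cases hcase : u < 9 / 5
  · refine (Pr_le_one _).trans ?_
    rw [mul_assoc, ← Real.rpow_add hQ0]
    have : 1 ≤ Q ^ (-1 / 5 + (2 - u)) := Real.one_le_rpow hQ1 (by linarith)
    linarith
  push Not at hcase
  set G : ℝ := (((c + d) ^ c : ℕ) : ℝ) with hGdef
  have hG1 : 1 ≤ G := by
    rw [hGdef]; exact_mod_cast Nat.one_le_pow _ _ (by omega)
  have hcG : (c : ℝ) ≤ G := by
    rw [hGdef]
    have : c ≤ (c + d) ^ c := (Nat.le_add_right c d).trans (Nat.le_self_pow (by omega) _)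
    exact_mod_cast this
  have hccG : (c : ℝ) ^ c ≤ G := by
    rw [hGdef]
    have : c ^ c ≤ (c + d) ^ c := Nat.pow_le_pow_left (by omega) _
    exact_mod_cast this
  have h2G : (2 : ℝ) ^ c ≤ G := by
    rw [hGdef]
    have : 2 ^ c ≤ (c + d) ^ c := Nat.pow_le_pow_left (by omega) _
    exact_mod_cast this
  have hkc : (k : ℝ) ^ c ≤ Q ^ ((1:ℝ) / 5) := by
    calc (k : ℝ) ^ c ≤ (Q ^ ((1 : ℝ) / (5 * (c : ℝ)))) ^ c := by gcongr
      _ = _ := by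
        rw [← Real.rpow_natCast, ← Real.rpow_mul hQ0.le]
        congr 1
        field_simp
  have hG4 : G ≤ G ^ 4 := le_self_pow₀ hG1 (by norm_num)
  have hG24 : G ^ 2 ≤ G ^ 4 := pow_le_pow_right₀ hG1 (by norm_num)
  obtain ⟨x, hx⟩ : ∃ x : ℝ, x = ((c * k : ℕ) : ℝ) ^ (2 * c) / 2 ^ s := ⟨_, rfl⟩
  have hx0 : 0 ≤ x := by rw [hx]; positivity
  have hxG : x ≤ G ^ 2 * Q ^ (-(3:ℝ) / 5) := by
    have e : Q ^ (-(3:ℝ) / 5) = (Q ^ ((1:ℝ) / 5)) ^ 2 / Q := by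
      rw [← Real.rpow_natCast, ← Real.rpow_mul hQ0.le]
      nth_rw 3 [← Real.rpow_one Q]
      rw [← Real.rpow_sub hQ0]
      norm_num
    rw [hx, e, ← hQ, mul_div_assoc']
    gcongr
    push_cast
    rw [mul_pow, mul_comm 2 c, pow_mul, pow_mul]
    gcongr
  have hx1 : x ≤ 1 := by
    refine hxG.trans ?_
    calc G ^ 2 * Q ^ (-(3:ℝ) / 5) ≤ Q ^ ((1:ℝ) / 40) * Q ^ (-(3:ℝ) / 5) := by
          gcongr; exact hG24.trans hG
      _ = Q ^ ((1:ℝ) / 40 + -(3:ℝ) / 5) := (Real.rpow_add hQ0 _ _).symm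
      _ ≤ 1 := Real.rpow_le_one_of_one_le_of_nonpos hQ1 (by norm_num)
  refine (finite_bound hc hd x hx hx1).trans ?_
  rw [← hQ, ← hu]
  set B : ℝ := (c : ℝ) * Q * 2 ^ d * x ^ u with hB
  have hB0 : 0 ≤ B := by positivity
  have hBle : B ≤ Q ^ ((41:ℝ) / 40 - 23 / 40 * u) := by
    have e1 : (2:ℝ) ^ d * x ^ u ≤ (Q ^ (-(23:ℝ) / 40)) ^ u := by
      rw [h2c, ← Real.mul_rpow (by positivity) hx0]
      apply Real.rpow_le_rpow (by positivity) _ hu0.le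
      calc (2:ℝ) ^ (2 * c) * x ≤ G ^ 2 * (G ^ 2 * Q ^ (-(3:ℝ) / 5)) := by
            rw [mul_comm 2 c, pow_mul]
            gcongr
        _ = G ^ 4 * Q ^ (-(3:ℝ) / 5) := by ring
        _ ≤ Q ^ ((1:ℝ) / 40) * Q ^ (-(3:ℝ) / 5) := by gcongr
        _ = Q ^ (-(23:ℝ) / 40) := by rw [← Real.rpow_add hQ0]; norm_num
    calc B = c * Q * (2 ^ d * x ^ u) := by rw [hB]; ring
      _ ≤ Q ^ ((1:ℝ) / 40) * Q ^ (1:ℝ) * (Q ^ (-(23:ℝ) / 40)) ^ u := by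
          rw [Real.rpow_one]
          gcongr
          exact hcG.trans (hG4.trans hG)
      _ = _ := by
          rw [← Real.rpow_mul hQ0.le, ← Real.rpow_add hQ0, ← Real.rpow_add hQ0]
          congr 1; ring
  have hBhalf : B ≤ 1 / 2 := by
    refine hBle.trans ?_
    calc Q ^ ((41:ℝ) / 40 - 23 / 40 * u) ≤ Q ^ (-(1:ℝ) / 100) :=
          Real.rpow_le_rpow_of_exponent_le hQ1 (by linarith)
      _ = (2:ℝ) ^ ((s:ℝ) * (-(1:ℝ) / 100)) := by
          rw [hQ, ← Real.rpow_natCast, ← Real.rpow_mul (by norm_num)]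
      _ ≤ (2:ℝ) ^ (-1:ℝ) := by
          apply Real.rpow_le_rpow_of_exponent_le (by norm_num)
          have : (100:ℝ) ≤ s := by exact_mod_cast hs
          linarith
      _ = 1 / 2 := by rw [Real.rpow_neg_one]; norm_num
  refine (geom_bound B hB0 hBhalf _).trans ?_
  rw [mul_assoc]
  gcongr 2 * ?_
  calc B ^ 2 ≤ (Q ^ ((41:ℝ) / 40 - 23 / 40 * u)) ^ 2 := by gcongr
    _ = Q ^ (((41:ℝ) / 40 - 23 / 40 * u) * 2) := by
        rw [← Real.rpow_natCast, ← Real.rpow_mul hQ0.le]; norm_num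
    _ ≤ Q ^ (-1 / 5 + (2 - u)) := Real.rpow_le_rpow_of_exponent_le hQ1 (by linarith)
    _ = _ := Real.rpow_add hQ0 _ _

/-- Double tabulation gives high independence (Theorem 7): let the
alphabet size be `Σ = 2^s` and consider parameters `c = c(s) ≥ 1` and `d = d(s) ≥ 1`
with `c = Σ^{o(1)}` and `(c+d)^c = Σ^{o(1)}` (expressed by their logarithms being
`o(log Σ) = o(s)`), and let `k = k(s) = ⌊Σ^{1/(5c)}⌋`.  Then the probability that a
random simple tabulation function `h₀ : Σ^c → Σ^d` fails to be `k`-unique is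
`o(Σ^{2−d/(2c)})` as `Σ → ∞`.  Moreover, whenever `h₀` is `k`-unique and
`h₁ : Σ^d → [2^r]` is an independent random simple tabulation function, `h₁ ∘ h₀` is
`k`-independent: each value is uniform in `[2^r]` and any `k` distinct keys get
mutually independent values. -/
theorem double_tabulation_high_independence
    (c d : ℕ → ℕ) (hc : ∀ s, 1 ≤ c s) (hd : ∀ s, 1 ≤ d s)
    (hco : (fun s : ℕ => Real.log (c s)) =o[Filter.atTop] fun s : ℕ => (s : ℝ))
    (hcdo : (fun s : ℕ => Real.log (((c s + d s) ^ c s : ℕ) : ℝ))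
              =o[Filter.atTop] fun s : ℕ => (s : ℝ))
    (k : ℕ → ℕ)
    (hk : ∀ s, k s = ⌊((2 : ℝ) ^ s) ^ ((1 : ℝ) / (5 * (c s : ℝ)))⌋₊) :
    ((fun s : ℕ => Pr (fun T : Fin (c s) → Bits s → (Fin (d s) → Bits s) =>
          ¬ KUnique (fun x : Fin (c s) → Bits s => simpleTab T x) (k s)))
        =o[Filter.atTop]
      fun s : ℕ => ((2 : ℝ) ^ s) ^ ((2 : ℝ) - (d s : ℝ) / (2 * (c s : ℝ)))) ∧
    ∀ (s r : ℕ) (T₀ : Fin (c s) → Bits s → (Fin (d s) → Bits s)),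
      KUnique (fun x : Fin (c s) → Bits s => simpleTab T₀ x) (k s) →
      (∀ (x : Fin (c s) → Bits s) (a : Bits r),
          Pr (fun T₁ : Fin (d s) → Bits s → Bits r =>
            simpleTab T₁ (simpleTab T₀ x) = a) = 1 / 2 ^ r) ∧
      ∀ (x : Fin (k s) → (Fin (c s) → Bits s)), Function.Injective x →
        ∀ a : Fin (k s) → Bits r,
          Pr (fun T₁ : Fin (d s) → Bits s → Bits r =>
              ∀ i, simpleTab T₁ (simpleTab T₀ (x i)) = a i) =
            (1 / 2 ^ r) ^ k s := by
  refine ⟨?_, ?_⟩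
  · rw [isLittleO_iff]
    intro ε hε
    have hG : ∀ᶠ s : ℕ in Filter.atTop,
        (((c s + d s) ^ c s : ℕ) : ℝ) ^ 4 ≤ ((2 : ℝ) ^ s) ^ ((1 : ℝ) / 40) := by
      have := (isLittleO_iff.1 hcdo) (c := 1 / 400) (by norm_num)
      filter_upwards [this] with s hs
      have hpos : (0:ℝ) < (((c s + d s) ^ c s : ℕ) : ℝ) := by
        have := hc s
        have : 0 < (c s + d s) ^ c s := Nat.pow_pos (by omega)
        exact_mod_cast this
      have h1 := (le_abs_self _).trans hs
      rw [Real.norm_of_nonneg (by positivity)] at h1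
      rw [← Real.log_le_log_iff (by positivity) (by positivity), Real.log_pow,
        Real.log_rpow (by positivity), Real.log_pow]
      have hs0 : (0:ℝ) ≤ s := by positivity
      have := Real.log_two_gt_d9
      push_cast at h1 ⊢
      nlinarith
    have hT : Filter.Tendsto (fun s : ℕ => 2 * ((2 : ℝ) ^ s) ^ (-(1 : ℝ) / 5))
        Filter.atTop (nhds 0) := by
      have h1 : Filter.Tendsto (fun s : ℕ => (2 : ℝ) ^ s) Filter.atTop Filter.atTop :=
        tendsto_pow_atTop_atTop_of_one_lt (by norm_num)
      have h2 := (tendsto_rpow_neg_atTop (y := 1 / 5) (by norm_num)).comp h1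
      have h3 := h2.const_mul 2
      rw [mul_zero] at h3
      refine h3.congr (fun s => ?_)
      simp only [Function.comp]
      norm_num
    filter_upwards [hG, Filter.eventually_ge_atTop 100, hT.eventually_le_const hε]
      with s hs1 hs2 hs3
    have hpr : 0 ≤ Pr (fun T : Fin (c s) → Bits s → (Fin (d s) → Bits s) =>
          ¬ KUnique (fun x : Fin (c s) → Bits s => simpleTab T x) (k s)) := by
      unfold Pr; positivity
    rw [Real.norm_of_nonneg hpr, Real.norm_of_nonneg (by positivity)]
    refine (core_bound (hc s) (hd s) hs2 ?_ hs1).trans ?_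
    · rw [hk s]
      exact Nat.floor_le (by positivity)
    · gcongr
  · intro s r T₀ hU
    refine ⟨fun x a => ?_, fun x hx a => ?_⟩
    · exact unif_part (hd s) (fun x => simpleTab T₀ x) x a
    · exact indep_part (fun x => simpleTab T₀ x) hU x hx a
end

section
/- Double tabulation is fully random on any given not-too-large set (Theorem 8): for all constants c ≥ 1, d ≥ 1 and δ > 0 there exists a constant C such that the following holds. Let S ⊆ Σ^c be a given set of at most (1−δ)|Σ| keys, and let h_0 : Σ^c → Σ^d and h_1 : Σ^d → [2^r] be independent random simple tabulation functions. Then with probability at least 1 − C·|Σ|^{1−⌊d/2⌋}, every nonempty subset X ⊆ S has a unique output character under h_0; and conditioned on any fixed outcome of h_0 with this property, the restriction of h_1 ∘ h_0 to S is fully random, i.e., the values (h_1(h_0(x)))_{x∈S} are independent and each uniform in [2^r]. -/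
open scoped Classical
open Finset

/-- A key set `X` has a unique output character under `f : Σ^c → Σ^d` if some `x ∈ X`
and position `j ∈ [d]` satisfy `f(y)_j ≠ f(x)_j` for all `y ∈ X \ {x}`. -/
def UniqueOutputChar {s c d : ℕ} (f : (Fin c → Bits s) → Fin d → Bits s)
    (X : Finset (Fin c → Bits s)) : Prop :=
  ∃ x ∈ X, ∃ j : Fin d, ∀ y ∈ X, y ≠ x → f y j ≠ f x j

theorem pr_nonneg {Ω : Type*} [Fintype Ω] (E : Ω → Prop) : 0 ≤ Pr E := by
  unfold Pr; positivity

theorem pr_mono {Ω : Type*} [Fintype Ω] {E F : Ω → Prop} (h : ∀ x, E x → F x) : Pr E ≤ Pr F := by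
  unfold Pr
  gcongr ?_ / _
  exact_mod_cast Finset.card_le_card (fun x hx => by
    simp only [Finset.mem_filter, Finset.mem_univ, true_and] at hx ⊢; exact h x hx)

theorem pr_eq {Ω : Type*} [Fintype Ω] (E : Ω → Prop) [DecidablePred E] :
    Pr E = ((Finset.univ.filter E).card : ℝ) / (Fintype.card Ω : ℝ) := by
  unfold Pr
  congr!

theorem pr_union {Ω ι : Type*} [Fintype Ω] (s : Finset ι) (E : ι → Ω → Prop) :
    Pr (fun x => ∃ i ∈ s, E i x) ≤ ∑ i ∈ s, Pr (E i) := by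
  simp only [pr_eq]
  rw [← Finset.sum_div]
  gcongr
  have : (Finset.univ.filter (fun x => ∃ i ∈ s, E i x)) ⊆
      s.biUnion (fun i => Finset.univ.filter (E i)) := by
    intro x hx
    simpa using hx
  exact_mod_cast (Finset.card_le_card this).trans Finset.card_biUnion_le

theorem pr_not {Ω : Type*} [Fintype Ω] [Nonempty Ω] (E : Ω → Prop) :
    Pr E = 1 - Pr (fun x => ¬ E x) := by
  simp only [pr_eq]
  have h := Finset.card_filter_add_card_filter_not (s := (Finset.univ : Finset Ω)) E
  have h2 : (Fintype.card Ω : ℝ) ≠ 0 := by positivity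
  rw [eq_sub_iff_add_eq, ← add_div, div_eq_one_iff_eq h2]
  rw [Finset.card_univ] at h
  exact_mod_cast h

theorem pr_hom {G H : Type*} [Fintype G] [Fintype H] [AddCommGroup G] [AddCommGroup H]
    (φ : G →+ H) (hφ : Function.Surjective φ) (E : H → Prop) :
    Pr (fun g => E (φ g)) = Pr E := by
  have hfib : ∀ h : H, (Finset.univ.filter (fun g => φ g = h)).card =
      (Finset.univ.filter (fun g => φ g = 0)).card := by
    intro h
    obtain ⟨g0, rfl⟩ := hφ h
    refine Finset.card_bij (fun g _ => g - g0) ?_ ?_ ?_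
    · intro a ha; simp at ha ⊢; simp [ha]
    · intro a _ b _ hab; simpa using hab
    · intro b hb; refine ⟨b + g0, ?_, ?_⟩ <;> simp at hb ⊢; simp [hb]
  set N := (Finset.univ.filter (fun g => φ g = 0)).card with hN
  have hE : ∀ E : H → Prop, (Finset.univ.filter (fun g => E (φ g))).card =
      (Finset.univ.filter E).card * N := by
    intro E
    rw [Finset.card_eq_sum_card_fiberwise (f := φ) (t := Finset.univ.filter E)]
    · rw [Finset.sum_const_nat]
      intro h hh
      rw [← hfib h, Finset.filter_filter]
      congr 1
      ext g
      simp at hh ⊢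
      rintro rfl; exact hh
    · intro g hg; simpa using hg
  have hN0 : 0 < N := Finset.card_pos.mpr ⟨0, by simp⟩
  have hG : Fintype.card G = Fintype.card H * N := by
    have := hE (fun _ => True)
    simpa using this
  unfold Pr
  rw [hE, hG]
  push_cast
  rw [mul_div_mul_right]
  positivity

theorem pr_pi {ι A : Type*} [Fintype ι] [DecidableEq ι] [Fintype A] (E : A → Prop) :
    Pr (fun f : ι → A => ∀ i, E (f i)) = (Pr E) ^ Fintype.card ι := by
  simp only [pr_eq]
  have : (Finset.univ.filter (fun f : ι → A => ∀ i, E (f i))) =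
      Fintype.piFinset (fun _ : ι => Finset.univ.filter E) := by
    ext f; simp
  rw [this, Fintype.card_piFinset, Fintype.card_fun]
  simp [div_pow]

theorem pr_linear {α ι V : Type*} [Fintype α] [DecidableEq α] [Fintype ι] [AddCommGroup V] [Module (ZMod 2) V]
    [Fintype V] (v : ι → α → ZMod 2) (hv : LinearIndependent (ZMod 2) v) (g : ι → V) :
    Pr (fun T : α → V => ∀ t, ∑ a, v t a • T a = g t) =
      (1 / (Fintype.card V : ℝ)) ^ Fintype.card ι := by
  let φ : (α → V) →+ (ι → V) :=
    { toFun := fun T t => ∑ a, v t a • T a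
      map_zero' := by ext; simp
      map_add' := by intro x y; ext t; simp [Finset.sum_add_distrib] }
  have hsurj : Function.Surjective φ := by
    have h1 : ∀ s : ι, ∃ w : α → ZMod 2, ∀ t, ∑ a, v t a * w a = if t = s then 1 else 0 := by
      intro s
      have hinj : LinearMap.ker (Fintype.linearCombination (ZMod 2) v) = ⊥ := by
        rw [LinearMap.ker_eq_bot]
        exact hv.fintypeLinearCombination_injective
      obtain ⟨L, hL⟩ := LinearMap.exists_leftInverse_of_injective _ hinj
      refine ⟨fun a => L (Pi.single a 1) s, fun t => ?_⟩
      have h2 : L (v t) s = if t = s then 1 else 0 := by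
        have := congrArg (fun M => M (Pi.single t 1) s) hL
        simp [Fintype.linearCombination_apply_single] at this
        rw [this, Pi.single_apply]
        simp [eq_comm]
      rw [← h2]
      conv_rhs => rw [← Finset.univ_sum_single (v t)]
      rw [map_sum, Finset.sum_apply]
      refine Finset.sum_congr rfl fun a _ => ?_
      have : Pi.single a (v t a) = v t a • (Pi.single a (1 : ZMod 2) : α → ZMod 2) := by
        rw [← Pi.single_smul]; simp
      rw [this, map_smul]; simp
    choose w hw using h1
    intro g
    refine ⟨fun a => ∑ s, w s a • g s, ?_⟩
    ext t
    show ∑ a, v t a • ∑ s, w s a • g s = g t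
    simp_rw [Finset.smul_sum, smul_smul]
    rw [Finset.sum_comm]
    simp_rw [← Finset.sum_smul, hw]
    simp
  have h := pr_hom φ hsurj (fun y => y = g)
  have e : (fun T : α → V => ∀ t, ∑ a, v t a • T a = g t) = fun T => φ T = g := by
    ext T
    exact (funext_iff (f := φ T) (g := g)).symm
  rw [e, h]
  simp only [pr_eq]
  rw [Finset.filter_eq' Finset.univ g]
  simp

theorem part_two (d s r : ℕ) {K : Type*} (S : Finset K) (f : K → Fin d → Bits s)
    (h : ∀ X ⊆ S, X.Nonempty → ∃ x ∈ X, ∃ j : Fin d, ∀ y ∈ X, y ≠ x → f y j ≠ f x j)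
    (g : K → Bits r) :
    Pr (fun T₁ : Fin d → Bits s → Bits r => ∀ x ∈ S, simpleTab T₁ (f x) = g x) =
      (1 / 2 ^ r) ^ S.card := by
  let v : S → (Fin d × Bits s) → ZMod 2 := fun x p => if f x p.1 = p.2 then 1 else 0
  have hv : LinearIndependent (ZMod 2) v := by
    rw [Fintype.linearIndependent_iff]
    intro a ha
    by_contra hne
    push Not at hne
    obtain ⟨i0, hi0⟩ := hne
    obtain ⟨x, hx, j, hj⟩ := h ((Finset.univ.filter (fun i : S => a i ≠ 0)).map
      (Function.Embedding.subtype _)) (by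
        intro y hy; simp at hy; exact hy.1) ⟨i0, by simp [hi0]⟩
    simp at hx
    obtain ⟨hxS, hax⟩ := hx
    have h1 := congrFun ha (j, f x j)
    simp only [Finset.sum_apply, Pi.smul_apply, v, smul_eq_mul, Pi.zero_apply] at h1
    rw [Finset.sum_eq_single ⟨x, hxS⟩] at h1
    · simp at h1; exact hax h1
    · intro b _ hb
      by_cases hab : a b = 0
      · simp [hab]
      · have := hj b (by simp [hab]) (by intro h; exact hb (Subtype.ext h))
        simp [this]
    · simp
  have h1 := pr_linear (V := Bits r) v hv (fun x => g x)
  let φ : (Fin d → Bits s → Bits r) →+ (Fin d × Bits s → Bits r) :=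
    { toFun := fun T p => T p.1 p.2
      map_zero' := rfl
      map_add' := fun _ _ => rfl }
  have hφ : Function.Surjective φ := fun T => ⟨fun i a => T (i, a), rfl⟩
  rw [← pr_hom φ hφ] at h1
  have e : (fun T₁ : Fin d → Bits s → Bits r => ∀ x ∈ S, simpleTab T₁ (f x) = g x) =
      fun T₁ => ∀ t : S, ∑ a, v t a • φ T₁ a = g t := by
    ext T
    rw [Subtype.forall]
    refine forall₂_congr fun x hx => ?_
    have : ∑ a, v ⟨x, hx⟩ a • φ T a = simpleTab T (f x) := by
      rw [Fintype.sum_prod_type]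
      simp [v, φ, simpleTab]
    rw [this]
  rw [e, h1]
  simp [Bits]
theorem shearer_one {P A : Type*} [Fintype P] [Fintype A] (g : P → A → ℝ)
    (hg : ∀ p a, 0 ≤ g p a) (τ : P → P) (n : ℕ) : ∀ (s : Finset P), s.card = n →
    (∀ p ∈ s, τ p ≠ p) → ∀ z : P → A,
    ∑ y ∈ Finset.univ.filter (fun y : P → A => (∀ p, p ∉ s → y p = z p) ∧ ∀ p ∈ s, y p = y (τ p)),
      ∏ p ∈ s, g p (y p) ≤ ∏ p ∈ s, √(∑ a, g p a ^ 2) := by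
  have hle : ∀ p a, g p a ≤ √(∑ a, g p a ^ 2) := fun p a =>
    Real.le_sqrt_of_sq_le (Finset.single_le_sum (f := fun a => g p a ^ 2)
      (fun _ _ => by positivity) (Finset.mem_univ a))
  induction n using Nat.strong_induction_on with
  | _ n ih =>
  intro s hs hτ z
  rcases s.eq_empty_or_nonempty with rfl | hne
  · simp
    have : (Finset.univ.filter (fun y : P → A => ∀ p, y p = z p)) ⊆ {z} := by
      intro y hy; simp at hy ⊢; exact funext hy
    have := Finset.card_le_card this
    simpa using this
  by_cases hfix : ∃ p ∈ s, τ p ∉ s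
  · obtain ⟨p, hp, hτp⟩ := hfix
    have hps : (s.erase p).card < n := by
      rw [← hs]; exact Finset.card_erase_lt_of_mem hp
    have := ih _ hps (s.erase p) rfl (fun q hq => hτ q (Finset.mem_of_mem_erase hq))
      (Function.update z p (z (τ p)))
    rw [← Finset.mul_prod_erase s _ hp]
    refine le_trans ?_ (mul_le_mul (hle p (z (τ p))) this
      (Finset.sum_nonneg fun _ _ => Finset.prod_nonneg fun _ _ => hg _ _) (Real.sqrt_nonneg _))
    rw [Finset.mul_sum]
    refine (Finset.sum_congr rfl (g := fun y => g p (z (τ p)) *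
      ∏ q ∈ s.erase p, g q (y q)) ?_).trans_le ?_
    · intro y hy
      simp at hy
      rw [← Finset.mul_prod_erase s _ hp, hy.2 p hp, hy.1 _ hτp]
    · refine Finset.sum_le_sum_of_subset_of_nonneg ?_ (fun _ _ _ =>
        mul_nonneg (hg _ _) (Finset.prod_nonneg fun _ _ => hg _ _))
      intro y hy
      simp at hy ⊢
      refine ⟨fun q hq => ?_, fun q _ hq => hy.2 q hq⟩
      by_cases hqp : q = p
      · subst hqp; simp [hy.2 q hp, hy.1 _ hτp]
      · rw [Function.update_of_ne hqp]; exact hy.1 q (hq hqp)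
  · push Not at hfix
    obtain ⟨p, hp⟩ := hne
    have hq := hfix p hp
    have hqp := hτ p hp
    set q := τ p with hqdef
    have hq' : q ∈ s.erase p := Finset.mem_erase.mpr ⟨hqp, hq⟩
    set s' := (s.erase p).erase q with hs'
    have hps : s'.card < n := by
      rw [← hs]
      exact (Finset.card_erase_lt_of_mem hq').trans (Finset.card_erase_lt_of_mem hp)
    have hsplit : ∀ F : P → ℝ, ∏ r ∈ s, F r = F p * F q * ∏ r ∈ s', F r := by
      intro F
      rw [← Finset.mul_prod_erase s _ hp, ← Finset.mul_prod_erase _ _ hq', mul_assoc]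
    rw [hsplit]
    have key : ∑ y ∈ Finset.univ.filter (fun y : P → A => (∀ p, p ∉ s → y p = z p) ∧
        ∀ p ∈ s, y p = y (τ p)), ∏ p ∈ s, g p (y p) ≤
        ∑ a, g p a * g q a * ∏ r ∈ s', √(∑ a, g r a ^ 2) := by
      rw [← Finset.sum_fiberwise _ (fun y : P → A => y p)]
      refine Finset.sum_le_sum fun a _ => ?_
      have := ih _ hps s' rfl (fun q hq => hτ q (by
        simp [hs'] at hq; exact hq.2.2))
        (Function.update (Function.update z p a) q a)
      refine le_trans ?_ (mul_le_mul_of_nonneg_left this (mul_nonneg (hg p a) (hg q a)))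
      rw [Finset.mul_sum]
      refine (Finset.sum_congr rfl (g := fun y => g p a * g q a *
        ∏ q ∈ s', g q (y q)) ?_).trans_le ?_
      · intro y hy
        simp at hy
        have h1 := hy.1.2 p hp
        rw [← hqdef, hy.2] at h1
        rw [hsplit, hy.2, ← h1]
      · refine Finset.sum_le_sum_of_subset_of_nonneg ?_ (fun _ _ _ =>
          mul_nonneg (mul_nonneg (hg _ _) (hg _ _)) (Finset.prod_nonneg fun _ _ => hg _ _))
        intro y hy
        simp only [Finset.mem_filter, Finset.mem_univ, true_and] at hy ⊢
        have h1 := hy.1.2 p hp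
        rw [← hqdef, hy.2] at h1
        refine ⟨fun r hr => ?_, fun r hr => hy.1.2 r (by simp [hs'] at hr; exact hr.2.2)⟩
        by_cases hrq : r = q
        · subst hrq; simp [← h1]
        · rw [Function.update_of_ne hrq]
          by_cases hrp : r = p
          · subst hrp; simp [hy.2]
          · rw [Function.update_of_ne hrp]
            exact hy.1.1 r (fun h => hr (by simp [hs', hrq, hrp, h]))
    refine key.trans ?_
    rw [← Finset.sum_mul]
    refine mul_le_mul_of_nonneg_right ?_ (Finset.prod_nonneg fun _ _ => Real.sqrt_nonneg _)
    exact Real.sum_mul_le_sqrt_mul_sqrt _ _ _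

theorem shearer {P A : Type*} [Fintype P] [Fintype A] (s : Finset P) (c : ℕ) :
    ∀ (f : P → (Fin c → A) → ℝ) (_ : ∀ p a, 0 ≤ f p a) (τ : Fin c → P → P)
    (_ : ∀ i, ∀ p ∈ s, τ i p ≠ p) (z : P → Fin c → A),
    ∑ u ∈ Finset.univ.filter (fun u : P → Fin c → A => (∀ p, p ∉ s → u p = z p) ∧
      ∀ p ∈ s, ∀ i, u p i = u (τ i p) i),
      ∏ p ∈ s, f p (u p) ≤ ∏ p ∈ s, √(∑ a, f p a ^ 2) := by
  induction c with
  | zero =>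
    intro f hf τ hτ z
    have h1 : ∀ p (a : Fin 0 → A), √(∑ a, f p a ^ 2) = f p a := by
      intro p a
      rw [Fintype.sum_unique, Real.sqrt_sq (hf _ _)]
      congr 1; exact Subsingleton.elim _ _
    have h2 : (Finset.univ.filter (fun u : P → Fin 0 → A => (∀ p, p ∉ s → u p = z p) ∧
      ∀ p ∈ s, ∀ i, u p i = u (τ i p) i)) = {z} := by
      ext u
      have : u = z := Subsingleton.elim _ _
      rw [Finset.mem_filter, Finset.mem_singleton]
      exact ⟨fun _ => this, fun _ => ⟨Finset.mem_univ _, fun p _ => by rw [this],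
        fun p _ i => i.elim0⟩⟩
    rw [h2]
    simp [← h1 _ (z _)]
  | succ c ih =>
    intro f hf τ hτ z
    let e : ((P → A) × (P → Fin c → A)) ≃ (P → Fin (c+1) → A) :=
      { toFun := fun w p => Fin.cons (w.1 p) (w.2 p)
        invFun := fun u => (fun p => u p 0, fun p i => u p i.succ)
        left_inv := fun w => by simp
        right_inv := fun u => by
          ext p i
          refine Fin.cases ?_ (fun i => ?_) i <;> simp }
    have h1 := shearer_one (fun p a => √(∑ x, f p (Fin.cons a x) ^ 2))
      (fun p a => Real.sqrt_nonneg _) (τ 0) s.card s rfl (hτ 0) (fun p => z p 0)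
    have h2 : ∀ p, ∑ a, √(∑ x, f p (Fin.cons a x : Fin (c+1) → A) ^ 2) ^ 2 = ∑ a, f p a ^ 2 := by
      intro p
      simp_rw [Real.sq_sqrt (Finset.sum_nonneg fun _ _ => sq_nonneg (f p _))]
      rw [← Fintype.sum_prod_type']
      exact Fintype.sum_equiv (Fin.consEquiv (fun _ => A)) _ _ (fun x => rfl)
    simp_rw [h2] at h1
    refine le_trans ?_ h1
    rw [Finset.sum_filter, ← Equiv.sum_comp e, Fintype.sum_prod_type, Finset.sum_filter]
    refine Finset.sum_le_sum fun y _ => ?_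
    split_ifs with hy
    · refine le_trans ?_ (ih (fun p x => f p (Fin.cons (y p) x)) (fun p a => hf _ _)
        (fun i => τ i.succ) (fun i => hτ i.succ) (fun p i => z p i.succ))
      rw [Finset.sum_filter]
      refine Finset.sum_le_sum fun u _ => ?_
      split_ifs with h3 h4 h4
      · exact le_rfl
      · exfalso
        apply h4
        refine ⟨fun p hp => ?_, fun p hp i => ?_⟩
        · ext i
          have := congrFun (h3.1 p hp) i.succ
          simpa [e] using this
        · have := h3.2 p hp i.succ
          simpa [e] using this
      · exact Finset.prod_nonneg fun _ _ => hf _ _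
      · exact le_rfl
    · refine (Finset.sum_eq_zero fun u _ => ?_).le
      rw [if_neg]
      intro h3
      apply hy
      refine ⟨fun p hp => ?_, fun p hp => ?_⟩
      · have := congrFun (h3.1 p hp) 0
        simpa [e] using this
      · have := h3.2 p hp 0
        simpa [e] using this

theorem shearer_card {P A : Type*} [Fintype P] [Fintype A] (s : Finset P) (hs : s.card = 4) (c : ℕ)
    (S : Finset (Fin c → A)) (τ : Fin c → P → P)
    (hτ : ∀ i, ∀ p ∈ s, τ i p ≠ p) (z : P → Fin c → A) :
    (Finset.univ.filter (fun u : P → Fin c → A => (∀ p, p ∉ s → u p = z p) ∧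
      (∀ p ∈ s, ∀ i, u p i = u (τ i p) i) ∧ ∀ p ∈ s, u p ∈ S)).card ≤ S.card ^ 2 := by
  have h := shearer s c (fun _ x => if x ∈ S then 1 else 0) (fun p a => by
    positivity) τ hτ z
  have h1 : ∑ a : Fin c → A, (if a ∈ S then (1 : ℝ) else 0) ^ 2 = S.card := by
    simp
  simp only [h1, Finset.prod_const, hs] at h
  have h2 : √(S.card : ℝ) ^ 4 = (S.card : ℝ) ^ 2 := by
    rw [show 4 = 2 * 2 from rfl, pow_mul, Real.sq_sqrt (by positivity)]
  rw [h2] at h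
  have h3 : ((Finset.univ.filter (fun u : P → Fin c → A => (∀ p, p ∉ s → u p = z p) ∧
      (∀ p ∈ s, ∀ i, u p i = u (τ i p) i) ∧ ∀ p ∈ s, u p ∈ S)).card : ℝ) ≤ (S.card : ℝ) ^ 2 := by
    refine le_trans (le_of_eq ?_) h
    rw [Finset.card_eq_sum_ones]
    push_cast
    rw [Finset.sum_filter, Finset.sum_filter]
    refine Finset.sum_congr rfl fun u _ => ?_
    rw [Finset.prod_ite_zero]
    simp only [Finset.prod_const_one, ← ite_and, and_assoc]
  exact_mod_cast h3

theorem shearer_card' {P A : Type*} [Fintype P] [Fintype A] (s : Finset P) (hs : s.card = 4)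
    (c : ℕ) (S : Finset (Fin c → A)) (τ : Fin c → P → P)
    (hτ : ∀ i, ∀ p ∈ s, τ i p ≠ p) (z : P → Fin c → A) (U : Finset (P → Fin c → A))
    (hU : ∀ u ∈ U, (∀ p, p ∉ s → u p = z p) ∧
      (∀ p ∈ s, ∀ i, u p i = u (τ i p) i) ∧ ∀ p ∈ s, u p ∈ S) : U.card ≤ S.card ^ 2 := by
  refine le_trans (Finset.card_le_card ?_) (shearer_card s hs c S τ hτ z)
  intro u hu
  rw [Finset.mem_filter]
  exact ⟨Finset.mem_univ _, hU u hu⟩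

theorem count_code {P K D : Type*} [Fintype P] [Fintype K] [Fintype D] (S : Finset K)
    (F : Finset P) (U : Finset (P → K)) (hU : ∀ u ∈ U, ∀ p, p ∉ F → u p ∈ S)
    (code : (P → K) → D) (M : ℕ)
    (hM : ∀ r ∈ U, ∀ U' : Finset (P → K), (∀ u ∈ U', u ∈ U ∧
      (∀ p, p ∉ F → u p = r p) ∧ code u = code r) → U'.card ≤ M) :
    U.card ≤ M * (S.card ^ (Fintype.card P - F.card) * Fintype.card D) := by
  let f : (P → K) → ({p // p ∉ F} → K) × D := fun u => (fun p => u p, code u)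
  have h1 : U.card ≤ M * (U.image f).card := by
    refine Finset.card_le_mul_card_image U M fun b hb => ?_
    obtain ⟨r, hr, rfl⟩ := Finset.mem_image.mp hb
    refine hM r hr _ ?_
    intro u hu
    simp [f, funext_iff] at hu ⊢
    exact hu
  refine h1.trans (Nat.mul_le_mul_left _ ?_)
  have h2 : U.image f ⊆ (Fintype.piFinset (fun _ : {p // p ∉ F} => S)) ×ˢ Finset.univ := by
    intro b hb
    obtain ⟨r, hr, rfl⟩ := Finset.mem_image.mp hb
    simp [f]
    intro p hp; exact hU r hr p hp
  refine (Finset.card_le_card h2).trans ?_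
  rw [Finset.card_product, Fintype.card_piFinset]
  simp [Fintype.card_subtype_compl]
/-- Four keys such that every character is repeated. -/
def Z4 {s c : ℕ} (y : Fin 4 → Fin c → Bits s) : Prop :=
  ∀ p i, ∃ q, q ≠ p ∧ y q i = y p i

/-- Constant bounding the number of patterns. -/
def Zc (c : ℕ) : ℕ := Fintype.card (Fin c → Fin 4 → Fin 4)

theorem z4_total {s c : ℕ} (S : Finset (Fin c → Bits s)) :
    (Finset.univ.filter (fun y : Fin 4 → Fin c → Bits s => (∀ p, y p ∈ S) ∧ Z4 y)).card ≤
      Zc c * S.card ^ 2 := by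
  have hch : ∀ y : Fin 4 → Fin c → Bits s, ∃ τ : Fin c → Fin 4 → Fin 4, Z4 y →
      ∀ i p, τ i p ≠ p ∧ y (τ i p) i = y p i := by
    intro y
    by_cases h : Z4 y
    · choose τ hτ using h
      exact ⟨fun i p => τ p i, fun _ i p => hτ p i⟩
    · exact ⟨fun _ _ => 0, fun h' => absurd h' h⟩
  choose code hcode using hch
  have := count_code S Finset.univ
    (Finset.univ.filter (fun y : Fin 4 → Fin c → Bits s => (∀ p, y p ∈ S) ∧ Z4 y))
    (by simp) code (S.card ^ 2) (by
      intro r hr U' hU'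
      simp only [Finset.mem_filter, Finset.mem_univ, true_and] at hr
      refine shearer_card' Finset.univ (by simp) c S (code r)
        (fun i p _ => (hcode r hr.2 i p).1) r U' ?_
      intro u hu
      replace hu := hU' u hu
      simp only [Finset.mem_filter, Finset.mem_univ, true_and] at hu
      refine ⟨by simp, fun p _ i => ?_, fun p _ => hu.1.1 p⟩
      rw [← hu.2.2]
      exact ((hcode u hu.1.2 i p).2).symm)
  refine this.trans ?_
  simp [Zc, mul_comm]

/-- Number of repeated quadruples in `S` starting at `x`. -/
noncomputable def z4deg {s c : ℕ} (S : Finset (Fin c → Bits s)) (x : Fin c → Bits s) : ℕ :=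
  (Finset.univ.filter (fun y : Fin 4 → Fin c → Bits s =>
    ((∀ p, y p ∈ S) ∧ Z4 y) ∧ y 0 = x)).card

theorem z4_min {s c : ℕ} (S : Finset (Fin c → Bits s)) (hS : S.Nonempty) :
    ∃ x ∈ S, z4deg S x ≤ Zc c * S.card := by
  apply Finset.exists_le_of_sum_le hS
  have h := z4_total S
  rw [Finset.card_eq_sum_card_fiberwise (f := fun y => y 0) (t := S)] at h
  · simp only [Finset.filter_filter] at h
    refine h.trans ?_
    simp; nlinarith
  · intro y hy
    simp at hy
    exact hy.1 0

theorem degen {s c : ℕ} (S : Finset (Fin c → Bits s)) :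
    ∃ Dm : (Fin c → Bits s) → Finset (Fin c → Bits s),
      (∀ x ∈ S, x ∈ Dm x ∧ Dm x ⊆ S ∧ z4deg (Dm x) x ≤ Zc c * S.card) ∧
      ∀ X ⊆ S, X.Nonempty → ∃ x ∈ X, X ⊆ Dm x := by
  induction S using Finset.strongInduction with
  | H S ih =>
  rcases S.eq_empty_or_nonempty with rfl | hne
  · refine ⟨fun _ => ∅, by simp, ?_⟩
    intro X hX hX2
    rw [Finset.subset_empty.mp hX] at hX2
    simp at hX2
  obtain ⟨x, hx, hdeg⟩ := z4_min S hne
  obtain ⟨Dm, h1, h2⟩ := ih (S.erase x) (Finset.erase_ssubset hx)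
  refine ⟨Function.update Dm x S, ?_, ?_⟩
  · intro y hy
    by_cases hyx : y = x
    · subst hyx; simp [hx, hdeg]
    · rw [Function.update_of_ne hyx]
      obtain ⟨a, b, e⟩ := h1 y (Finset.mem_erase.mpr ⟨hyx, hy⟩)
      refine ⟨a, b.trans (Finset.erase_subset _ _), e.trans ?_⟩
      exact Nat.mul_le_mul_left _ (Finset.card_le_card (Finset.erase_subset _ _))
  · intro X hX hXne
    by_cases hxX : x ∈ X
    · exact ⟨x, hxX, by simpa using hX⟩
    · obtain ⟨y, hy, hy2⟩ := h2 X (fun z hz => Finset.mem_erase.mpr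
        ⟨fun h => hxX (h ▸ hz), hX hz⟩) hXne
      refine ⟨y, hy, ?_⟩
      rw [Function.update_of_ne]
      · exact hy2
      · rintro rfl; exact hxX hy

/-- Parity of a step. -/
def par {k : ℕ} (t : Fin k) : Bool := decide (t.val % 2 = 1)

/-- Equation vector of a step of a walk. -/
def vec {s c k : ℕ} (u : Fin (k + 2) → Fin c → Bits s) (t : Fin (k + 1)) :
    Bool × Fin c × Bits s → ZMod 2 := fun w =>
  if w.1 = par t then (if u t.castSucc w.2.1 = w.2.2 then 1 else 0) -
    (if u t.succ w.2.1 = w.2.2 then 1 else 0) else 0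

/-- Every key on the walk except the first and the last has a new character. -/
def NewChars {s c k : ℕ} (u : Fin (k + 2) → Fin c → Bits s) : Prop :=
  ∀ p : Fin (k + 2), p ≠ 0 → p ≠ Fin.last _ → ∃ i, ∀ q < p, u q i ≠ u p i

theorem vec_trivial {s c k : ℕ} (u : Fin (k + 2) → Fin c → Bits s) (hu : NewChars u)
    (g : Fin (k + 1) → ZMod 2) (hg : ∑ t, g t • vec u t = 0) (hl : g (Fin.last k) = 0) : g = 0 := by
  by_contra hne
  have hne2 : (Finset.univ.filter (fun t => g t ≠ 0)).Nonempty := by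
    by_contra h
    rw [Finset.not_nonempty_iff_eq_empty, Finset.filter_eq_empty_iff] at h
    apply hne
    ext t
    have := h (Finset.mem_univ t)
    rw [not_not] at this
    simp [this]
  obtain ⟨t, ht, hmax⟩ := Finset.exists_max_image _ (fun t => t) hne2
  simp only [Finset.mem_filter, Finset.mem_univ, true_and] at ht hmax
  have htl : t ≠ Fin.last k := by rintro rfl; exact ht hl
  obtain ⟨i, hi⟩ := hu t.succ (Fin.succ_ne_zero t) (by
    rw [← Fin.succ_last]; intro h; exact htl (Fin.succ_injective _ h))
  have h1 := congrFun hg (par t, i, u t.succ i)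
  simp only [Finset.sum_apply, Pi.smul_apply, smul_eq_mul, Pi.zero_apply] at h1
  rw [Finset.sum_eq_single t] at h1
  · have := hi t.castSucc Fin.castSucc_lt_succ
    simp [vec, this] at h1
    exact ht h1
  · intro t' _ ht'
    by_cases hg' : g t' = 0
    · simp [hg']
    · have hlt : t' < t := lt_of_le_of_ne (hmax t' hg') ht'
      have h2 := hi t'.castSucc (by
        rw [Fin.lt_def] at hlt ⊢; simp; omega)
      have h3 := hi t'.succ (by
        rw [Fin.lt_def] at hlt ⊢; simp; omega)
      simp [vec, h2, h3]
  · simp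

theorem vec_parity {s c k : ℕ} (u : Fin (k + 2) → Fin c → Bits s)
    (g : Fin (k + 1) → ZMod 2) (hg : ∑ t, g t • vec u t = 0) (t : Fin (k + 1)) (ht : g t ≠ 0)
    (p : Fin (k + 2)) (hp : p = t.castSucc ∨ p = t.succ) (i : Fin c) :
    ∃ t', g t' ≠ 0 ∧ par t' = par t ∧ ∃ q, (q = t'.castSucc ∨ q = t'.succ) ∧
      q ≠ p ∧ u q i = u p i := by
  by_contra hcon
  push Not at hcon
  have h1 := congrFun hg (par t, i, u p i)
  simp only [Finset.sum_apply, Pi.smul_apply, smul_eq_mul, Pi.zero_apply] at h1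
  rw [Finset.sum_eq_single t] at h1
  · rcases hp with rfl | rfl
    · have := hcon t ht rfl t.succ (Or.inr rfl) (Fin.castSucc_lt_succ).ne'
      simp [vec, this] at h1
      exact ht h1
    · have := hcon t ht rfl t.castSucc (Or.inl rfl) (Fin.castSucc_lt_succ).ne
      simp [vec, this] at h1
      exact ht h1
  · intro t' _ ht'
    by_cases hg' : g t' = 0
    · simp [hg']
    by_cases hpar : par t' = par t
    · have hpar2 := hpar
      simp only [par, decide_eq_decide] at hpar2
      have hne : t'.val ≠ t.val := fun h => ht' (Fin.ext h)
      have h2 := hcon t' hg' hpar t'.castSucc (Or.inl rfl) (by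
        rcases hp with rfl | rfl <;> simp [Fin.ext_iff] <;> omega)
      have h3 := hcon t' hg' hpar t'.succ (Or.inr rfl) (by
        rcases hp with rfl | rfl <;> simp [Fin.ext_iff] <;> omega)
      simp [vec, h2, h3]
    · have : par t ≠ par t' := fun h => hpar h.symm
      simp [vec, this]
  · simp

/-- Four special indices. -/
def Fj {k : ℕ} (j : Fin (k + 1)) : Finset (Fin (k + 2)) :=
  {j.castSucc, j.succ, (Fin.last k).castSucc, (Fin.last k).succ}

/-- First kind of dependency. -/
def B1 {s c k : ℕ} (u : Fin (k + 2) → Fin c → Bits s) (j : Fin (k + 1)) : Prop :=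
  (1 ≤ j.val ∧ j.val + 1 < k) ∧ ∀ p ∈ Fj j, ∀ i, ∃ q, q ≠ p ∧ u q i = u p i

/-- Second kind of dependency. -/
def B2 {s c k : ℕ} (u : Fin (k + 2) → Fin c → Bits s) : Prop :=
  2 ≤ k ∧ Z4 ![u 0, u 1, u (Fin.last k).castSucc, u (Fin.last k).succ]

theorem vec_dich {s c k : ℕ} (u : Fin (k + 2) → Fin c → Bits s) (hu : NewChars u)
    (hne : ∀ t : Fin (k + 1), u t.castSucc ≠ u t.succ)
    (h : ¬ LinearIndependent (ZMod 2) (vec u)) : (∃ j, B1 u j) ∨ B2 u := by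
  rw [Fintype.not_linearIndependent_iff] at h
  obtain ⟨g, hg, t0, ht0⟩ := h
  have hl : g (Fin.last k) ≠ 0 := by
    intro hl
    exact ht0 (by rw [vec_trivial u hu g hg hl]; rfl)
  by_cases hj : ∃ j : Fin (k + 1), g j ≠ 0 ∧ par j = par (Fin.last k) ∧ 1 ≤ j.val ∧ j.val < k
  · left
    obtain ⟨j, hgj, hpj, h1, h2⟩ := hj
    refine ⟨j, ⟨h1, ?_⟩, ?_⟩
    · simp only [par, decide_eq_decide, Fin.val_last] at hpj
      omega
    · intro p hp i
      have key : ∃ t, g t ≠ 0 ∧ (p = t.castSucc ∨ p = t.succ) := by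
        simp only [Fj, Finset.mem_insert, Finset.mem_singleton] at hp
        rcases hp with h | h | h | h
        · exact ⟨j, hgj, Or.inl h⟩
        · exact ⟨j, hgj, Or.inr h⟩
        · exact ⟨_, hl, Or.inl h⟩
        · exact ⟨_, hl, Or.inr h⟩
      obtain ⟨t, ht, hp⟩ := key
      obtain ⟨t', _, _, q, _, hq⟩ := vec_parity u g hg t ht p hp i
      exact ⟨q, hq⟩
  · right
    push Not at hj
    by_cases h0 : g 0 ≠ 0 ∧ par (0 : Fin (k + 1)) = par (Fin.last k) ∧ 1 ≤ k
    · have hk : 2 ≤ k := by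
        have := h0.2.1
        simp only [par, decide_eq_decide, Fin.val_last] at this
        simp at this
        omega
      refine ⟨hk, ?_⟩
      let e : Fin 4 → Fin (k + 2) := ![0, 1, (Fin.last k).castSucc, (Fin.last k).succ]
      have hy : ∀ p i, ![u 0, u 1, u (Fin.last k).castSucc, u (Fin.last k).succ] p i =
          u (e p) i := by
        intro p i; fin_cases p <;> rfl
      have he : ∀ p : Fin 4, ∃ t, g t ≠ 0 ∧ par t = par (Fin.last k) ∧
          (e p = t.castSucc ∨ e p = t.succ) := by
        intro p
        fin_cases p
        · exact ⟨0, h0.1, h0.2.1, Or.inl rfl⟩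
        · exact ⟨0, h0.1, h0.2.1, Or.inr rfl⟩
        · exact ⟨Fin.last k, hl, rfl, Or.inl rfl⟩
        · exact ⟨Fin.last k, hl, rfl, Or.inr rfl⟩
      intro p i
      obtain ⟨t, ht, hpt, hp⟩ := he p
      obtain ⟨t', ht', hpt', q, hq, hqp, hqu⟩ := vec_parity u g hg t ht _ hp i
      have : ∃ q' : Fin 4, e q' = q := by
        have h3 := hj t' ht' (hpt'.trans hpt)
        by_cases h4 : 1 ≤ t'.val
        · have h5 : t' = Fin.last k := Fin.ext (by
            have := h3 h4; have := t'.isLt; simp; omega)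
          subst h5
          rcases hq with rfl | rfl
          · exact ⟨2, rfl⟩
          · exact ⟨3, rfl⟩
        · have h5 : t' = 0 := Fin.ext (by show t'.val = 0; omega)
          subst h5
          rcases hq with rfl | rfl
          · exact ⟨0, rfl⟩
          · exact ⟨1, rfl⟩
      obtain ⟨q', rfl⟩ := this
      refine ⟨q', fun h => hqp (by rw [h]), ?_⟩
      rw [hy, hy, hqu]
    · exfalso
      apply hne (Fin.last k)
      ext1 i
      obtain ⟨t', ht', hpt', q, hq, hqp, hqu⟩ := vec_parity u g hg (Fin.last k) hl _ (Or.inl rfl) i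
      have h5 : t' = Fin.last k := by
        by_contra hne'
        have hlt : t'.val < k := by
          have := t'.isLt
          have : t'.val ≠ k := fun h => hne' (Fin.ext h)
          omega
        by_cases h4 : 1 ≤ t'.val
        · have := hj t' ht' hpt' h4
          omega
        · have h6 : t' = 0 := Fin.ext (by show t'.val = 0; omega)
          subst h6
          exact h0 ⟨ht', hpt', by omega⟩
      subst h5
      rcases hq with rfl | rfl
      · exact absurd rfl hqp
      · exact hqu.symm
/-- The possible walks starting at `x`. -/
noncomputable def Wk {s c : ℕ} (k : ℕ) (S : Finset (Fin c → Bits s)) (x : Fin c → Bits s) :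
    Finset (Fin (k + 2) → Fin c → Bits s) :=
  Finset.univ.filter (fun u => u 0 = x ∧ (∀ p, u p ∈ S) ∧ NewChars u ∧
    (∀ i, ∃ q, q ≠ Fin.last _ ∧ u q i = u (Fin.last _) i) ∧
    ∀ t : Fin (k + 1), u t.castSucc ≠ u t.succ)

theorem mem_Wk {s c k : ℕ} {S : Finset (Fin c → Bits s)} {x : Fin c → Bits s}
    {u : Fin (k + 2) → Fin c → Bits s} : u ∈ Wk k S x ↔ u 0 = x ∧ (∀ p, u p ∈ S) ∧ NewChars u ∧
    (∀ i, ∃ q, q ≠ Fin.last _ ∧ u q i = u (Fin.last _) i) ∧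
    ∀ t : Fin (k + 1), u t.castSucc ≠ u t.succ := by
  simp [Wk]

theorem card_Wk {s c k : ℕ} (S : Finset (Fin c → Bits s)) (x : Fin c → Bits s) :
    (Wk k S x).card ≤ S.card ^ k * (k + 2) ^ c := by
  have hch : ∀ u : Fin (k + 2) → Fin c → Bits s, ∃ τ : Fin c → Fin (k + 2), u ∈ Wk k S x →
      ∀ i, τ i ≠ Fin.last _ ∧ u (τ i) i = u (Fin.last _) i := by
    intro u
    by_cases h : u ∈ Wk k S x
    · choose τ hτ using (mem_Wk.mp h).2.2.2.1
      exact ⟨τ, fun _ => hτ⟩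
    · exact ⟨fun _ => 0, fun h' => absurd h' h⟩
  choose code hcode using hch
  have := count_code S {0, Fin.last (k + 1)} (Wk k S x) (fun u hu p _ => (mem_Wk.mp hu).2.1 p)
    code 1 (by
      intro r hr U' hU'
      rw [Finset.card_le_one]
      have key : ∀ u ∈ U', u = r := by
        intro u hu
        replace hu := hU' u hu
        obtain ⟨hu, hu2, hu3⟩ := hu
        have h1 : ∀ p, p ≠ Fin.last (k + 1) → u p = r p := by
          intro p hp
          by_cases hp0 : p = 0
          · rw [hp0, (mem_Wk.mp hu).1, (mem_Wk.mp hr).1]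
          · exact hu2 p (by simp [hp, hp0])
        ext1 p
        by_cases hp : p = Fin.last (k + 1)
        · subst hp
          ext1 i
          have h2 := hcode u hu i
          have h3 := hcode r hr i
          rw [← h2.2, ← h3.2, hu3, h1 _ h3.1]
        · exact h1 p hp
      intro a ha b hb
      rw [key a ha, key b hb])
  refine this.trans (le_of_eq ?_)
  have h0 : (0 : Fin (k + 2)) ≠ Fin.last (k + 1) := by simp [Fin.ext_iff]
  rw [Finset.card_pair h0]
  simp

theorem card_B1 {s c k : ℕ} (S : Finset (Fin c → Bits s)) (x : Fin c → Bits s) (j : Fin (k + 2)) :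
    ((Wk (k + 1) S x).filter (fun u => B1 u j)).card ≤ S.card ^ k * (k + 3) ^ (4 * c) := by
  by_cases hj : 1 ≤ j.val ∧ j.val + 1 < k + 1
  swap
  · rw [Finset.filter_false_of_mem]
    · simp
    · intro u _ hu; exact hj hu.1
  have hF4 : (Fj j).card = 4 := by
    rw [Fj, Finset.card_insert_of_notMem, Finset.card_insert_of_notMem,
      Finset.card_insert_of_notMem, Finset.card_singleton]
    all_goals simp only [Finset.mem_insert, Finset.mem_singleton, Fin.ext_iff, Fin.val_succ,
      Fin.val_castSucc, Fin.val_last]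
    all_goals omega
  have h0F : (0 : Fin (k + 3)) ∉ Fj j := by
    intro h
    simp only [Fj, Finset.mem_insert, Finset.mem_singleton, Fin.ext_iff, Fin.val_succ,
      Fin.val_castSucc, Fin.val_last, Fin.val_zero] at h
    omega
  set U := (Wk (k + 1) S x).filter (fun u => B1 u j) with hUdef
  have hch : ∀ u : Fin (k + 3) → Fin c → Bits s, ∃ τ : Fin c → {p // p ∈ Fj j} → Fin (k + 3),
      u ∈ U → ∀ i p, τ i p ≠ p ∧ u (τ i p) i = u p i := by
    intro u
    by_cases h : u ∈ U
    · choose τ hτ using (Finset.mem_filter.mp h).2.2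
      exact ⟨fun i p => τ p.1 p.2 i, fun _ i p => hτ p.1 p.2 i⟩
    · exact ⟨fun _ _ => 0, fun h' => absurd h' h⟩
  choose code hcode using hch
  have := count_code S (insert 0 (Fj j)) U
    (fun u hu p _ => (mem_Wk.mp (Finset.mem_filter.mp hu).1).2.1 p)
    code (S.card ^ 2) (by
      intro r hr U' hU'
      refine shearer_card' (Fj j) hF4 c S
        (fun i p => if h : p ∈ Fj j then code r i ⟨p, h⟩ else p) (by
          intro i p hp
          simp only [hp, dif_pos]
          exact (hcode r hr i ⟨p, hp⟩).1) r U' ?_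
      intro u hu
      replace hu := hU' u hu
      obtain ⟨hu, hu2, hu3⟩ := hu
      refine ⟨?_, ?_, ?_⟩
      · intro p hp
        by_cases hp0 : p = 0
        · rw [hp0, (mem_Wk.mp (Finset.mem_filter.mp hu).1).1,
            (mem_Wk.mp (Finset.mem_filter.mp hr).1).1]
        · exact hu2 p (by simp [hp, hp0])
      · intro p hp i
        simp only [hp, dif_pos]
        rw [← hu3]
        exact ((hcode u hu i ⟨p, hp⟩).2).symm
      · intro p _
        exact (mem_Wk.mp (Finset.mem_filter.mp hu).1).2.1 p)
  refine this.trans (le_of_eq ?_)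
  rw [Finset.card_insert_of_notMem h0F, hF4]
  simp only [Fintype.card_fun, Fintype.card_fin, Fintype.card_coe, hF4]
  rw [← mul_assoc, ← pow_add, ← pow_mul]
  congr 2
  omega

theorem card_B2 {s c k : ℕ} (S : Finset (Fin c → Bits s)) (x : Fin c → Bits s) (m : ℕ)
    (hm : S.card ≤ m) (hdeg : z4deg S x ≤ Zc c * m) :
    ((Wk (k + 1) S x).filter (fun u => B2 u)).card ≤ Zc c * m ^ k := by
  by_cases hk : 2 ≤ k + 1
  swap
  · rw [Finset.filter_false_of_mem]
    · simp
    · intro u _ hu; exact hk hu.1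
  set F : Finset (Fin (k + 3)) := {0, 1, (Fin.last (k + 1)).castSucc, (Fin.last (k + 1)).succ}
    with hF
  have hF4 : F.card = 4 := by
    rw [hF, Finset.card_insert_of_notMem, Finset.card_insert_of_notMem,
      Finset.card_insert_of_notMem, Finset.card_singleton]
    all_goals simp [Fin.ext_iff]
    all_goals omega
  set U := (Wk (k + 1) S x).filter (fun u => B2 u) with hUdef
  have := count_code S F U
    (fun u hu p _ => (mem_Wk.mp (Finset.mem_filter.mp hu).1).2.1 p)
    (fun _ => ()) (Zc c * m) (by
      intro r hr U' hU'
      refine le_trans ?_ hdeg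
      refine Finset.card_le_card_of_injOn (fun u => ![u 0, u 1, u (Fin.last (k + 1)).castSucc,
        u (Fin.last (k + 1)).succ]) ?_ ?_
      · intro u hu
        replace hu := hU' u hu
        have hW := mem_Wk.mp (Finset.mem_filter.mp hu.1).1
        have hB := (Finset.mem_filter.mp hu.1).2
        rw [Finset.mem_coe, Finset.mem_filter]
        refine ⟨Finset.mem_univ _, ⟨?_, hB.2⟩, hW.1⟩
        intro p
        fin_cases p <;> exact hW.2.1 _
      · intro u hu v hv huv
        replace hu := hU' u hu
        replace hv := hU' v hv
        ext1 p
        by_cases hp : p ∈ F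
        · simp only [hF, Finset.mem_insert, Finset.mem_singleton] at hp
          rcases hp with rfl | rfl | rfl | rfl
          · exact congrFun huv 0
          · exact congrFun huv 1
          · exact congrFun huv 2
          · exact congrFun huv 3
        · rw [hu.2.1 p hp, hv.2.1 p hp])
  refine this.trans ?_
  rw [hF4]
  simp only [Fintype.card_fin, Fintype.card_unit, mul_one]
  obtain ⟨k, rfl⟩ : ∃ l, k = l + 1 := ⟨k - 1, by omega⟩
  have : k + 1 + 3 - 4 = k := by omega
  simp only [this]
  rw [pow_succ m, mul_assoc, mul_comm m]
  gcongr

/-- All equations along a walk hold. -/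
def Ev {s c k : ℕ} (u : Fin (k + 2) → Fin c → Bits s) (R : Bool × Fin c × Bits s → Bits s) : Prop :=
  ∀ t : Fin (k + 1), simpleTab (fun i a => R (par t, i, a)) (u t.castSucc) =
    simpleTab (fun i a => R (par t, i, a)) (u t.succ)

theorem vec_sum {s c k : ℕ} (u : Fin (k + 2) → Fin c → Bits s)
    (R : Bool × Fin c × Bits s → Bits s) (t : Fin (k + 1)) :
    ∑ a, vec u t a • R a = simpleTab (fun i a => R (par t, i, a)) (u t.castSucc) -
      simpleTab (fun i a => R (par t, i, a)) (u t.succ) := by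
  rw [Fintype.sum_prod_type, Finset.sum_eq_single (par t)]
  · rw [Fintype.sum_prod_type, simpleTab, simpleTab, ← Finset.sum_sub_distrib]
    refine Finset.sum_congr rfl fun i _ => ?_
    simp [vec, sub_smul]
  · intro b _ hb
    simp [vec, hb]
  · simp

theorem pr_Ev_li {s c k : ℕ} (u : Fin (k + 2) → Fin c → Bits s)
    (h : LinearIndependent (ZMod 2) (vec u)) : Pr (Ev u) = (1 / 2 ^ s) ^ (k + 1) := by
  have h1 := pr_linear (V := Bits s) (vec u) h 0
  have e : Ev u = fun T => ∀ t, ∑ a, vec u t a • T a = (0 : Fin (k + 1) → Bits s) t := by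
    ext R
    refine forall_congr' fun t => ?_
    rw [vec_sum, Pi.zero_apply, sub_eq_zero]
  rw [e, h1]
  simp [Bits]

theorem pr_Ev_new {s c k : ℕ} (u : Fin (k + 2) → Fin c → Bits s)
    (h : NewChars u) : Pr (Ev u) ≤ (1 / 2 ^ s) ^ k := by
  have hli : LinearIndependent (ZMod 2) (fun t : Fin k => vec u t.castSucc) := by
    rw [Fintype.linearIndependent_iff]
    intro g hg t
    have := vec_trivial u h (Fin.snoc g 0) (by
      rw [Fin.sum_univ_castSucc]
      simpa using hg) (by simp)
    have := congrFun this t.castSucc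
    simpa using this
  have h1 := pr_linear (V := Bits s) _ hli 0
  have h2 : Pr (Ev u) ≤ Pr (fun T : Bool × Fin c × Bits s → Bits s => ∀ t : Fin k, ∑ a, vec u t.castSucc a • T a =
      (0 : Fin k → Bits s) t) := by
    refine pr_mono fun R hR t => ?_
    rw [vec_sum, Pi.zero_apply, sub_eq_zero]
    exact hR _
  rw [h1] at h2
  simpa [Bits] using h2

theorem pr_walk {s c k : ℕ} (S : Finset (Fin c → Bits s)) (x : Fin c → Bits s) (m : ℕ)
    (hm : S.card ≤ m) (hdeg : z4deg S x ≤ Zc c * m) (q : ℝ) (hq1 : q ≤ 1) (hq0 : 0 ≤ q)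
    (hmq : (m : ℝ) ≤ q * 2 ^ s) :
    Pr (fun R => ∃ u ∈ Wk (k + 1) S x, Ev u R) ≤
      (1 / 2 ^ s) * ((2 + Zc c) * ((k + 3 : ℕ) : ℝ) ^ (4 * c + 1) * q ^ k) := by
  set n : ℝ := 2 ^ s with hn
  have hn0 : 0 < n := by positivity
  set W := Wk (k + 1) S x with hW
  have hA : (((W.filter (fun u => LinearIndependent (ZMod 2) (vec u))).card : ℕ) : ℝ) ≤
      (m : ℝ) ^ (k + 1) * ((k + 3 : ℕ) : ℝ) ^ c := by
    have : (W.filter (fun u => LinearIndependent (ZMod 2) (vec u))).card ≤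
        m ^ (k + 1) * (k + 3) ^ c := by
      refine (Finset.card_filter_le _ _).trans ((card_Wk S x).trans ?_)
      gcongr
    exact_mod_cast this
  have hB : (((W.filter (fun u => ¬ LinearIndependent (ZMod 2) (vec u))).card : ℕ) : ℝ) ≤
      (m : ℝ) ^ k * (((k + 3 : ℕ) : ℝ) ^ (4 * c + 1) + Zc c) := by
    have : (W.filter (fun u => ¬ LinearIndependent (ZMod 2) (vec u))).card ≤
        m ^ k * ((k + 3) ^ (4 * c + 1) + Zc c) := by
      have hsub : W.filter (fun u => ¬ LinearIndependent (ZMod 2) (vec u)) ⊆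
          (Finset.univ.biUnion (fun j => W.filter (fun u => B1 u j))) ∪
            W.filter (fun u => B2 u) := by
        intro u hu
        rw [Finset.mem_filter] at hu
        have h1 := mem_Wk.mp hu.1
        rcases vec_dich u h1.2.2.1 h1.2.2.2.2 hu.2 with ⟨j, hj⟩ | h
        · refine Finset.mem_union_left _ (Finset.mem_biUnion.mpr ⟨j, Finset.mem_univ _, ?_⟩)
          exact Finset.mem_filter.mpr ⟨hu.1, hj⟩
        · exact Finset.mem_union_right _ (Finset.mem_filter.mpr ⟨hu.1, h⟩)
      refine (Finset.card_le_card hsub).trans ((Finset.card_union_le _ _).trans ?_)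
      rw [mul_add]
      refine add_le_add ?_ ?_
      · refine Finset.card_biUnion_le.trans ?_
        refine (Finset.sum_le_card_nsmul _ _ (m ^ k * (k + 3) ^ (4 * c)) ?_).trans ?_
        · intro j _
          refine (card_B1 S x j).trans ?_
          gcongr
        · simp only [Finset.card_univ, Fintype.card_fin, smul_eq_mul]
          have : k + 1 + 1 ≤ k + 3 := by omega
          calc (k + 1 + 1) * (m ^ k * (k + 3) ^ (4 * c))
              ≤ (k + 3) * (m ^ k * (k + 3) ^ (4 * c)) := Nat.mul_le_mul_right _ this
            _ = _ := by ring
      · rw [mul_comm]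
        exact card_B2 S x m hm hdeg
    exact_mod_cast this
  refine (pr_union W (fun u => Ev u)).trans ?_
  rw [← Finset.sum_filter_add_sum_filter_not W (fun u => LinearIndependent (ZMod 2) (vec u))]
  have h1 : ∑ u ∈ W.filter (fun u => LinearIndependent (ZMod 2) (vec u)), Pr (Ev u) ≤
      (m : ℝ) ^ (k + 1) * ((k + 3 : ℕ) : ℝ) ^ c * (1 / n) ^ (k + 2) := by
    rw [Finset.sum_congr rfl (fun u hu => pr_Ev_li u (Finset.mem_filter.mp hu).2),
      Finset.sum_const, nsmul_eq_mul]
    exact mul_le_mul_of_nonneg_right hA (by positivity)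
  have h2 : ∑ u ∈ W.filter (fun u => ¬ LinearIndependent (ZMod 2) (vec u)), Pr (Ev u) ≤
      (m : ℝ) ^ k * (((k + 3 : ℕ) : ℝ) ^ (4 * c + 1) + Zc c) * (1 / n) ^ (k + 1) := by
    refine (Finset.sum_le_card_nsmul _ _ ((1 / n) ^ (k + 1)) (fun u hu =>
      pr_Ev_new u (mem_Wk.mp (Finset.mem_filter.mp hu).1).2.2.1)).trans ?_
    rw [nsmul_eq_mul]
    exact mul_le_mul_of_nonneg_right hB (by positivity)
  refine (add_le_add h1 h2).trans ?_
  set y : ℝ := (m : ℝ) * (1 / n) with hy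
  have hy0 : 0 ≤ y := by positivity
  have hyq : y ≤ q := by
    rw [hy, mul_one_div, div_le_iff₀ hn0]; exact hmq
  set K : ℝ := ((k + 3 : ℕ) : ℝ) with hK
  have hK1 : 1 ≤ K := by rw [hK]; push_cast; linarith [Nat.cast_nonneg (α := ℝ) k]
  have e : (m : ℝ) ^ (k + 1) * K ^ c * (1 / n) ^ (k + 2) +
      (m : ℝ) ^ k * (K ^ (4 * c + 1) + Zc c) * (1 / n) ^ (k + 1) =
      1 / n * ((y * K ^ c + K ^ (4 * c + 1) + Zc c) * y ^ k) := by
    rw [hy]; ring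
  rw [e]
  have h3 : y ^ k ≤ q ^ k := by gcongr
  have h4 : K ^ c ≤ K ^ (4 * c + 1) := pow_le_pow_right₀ hK1 (by omega)
  have h5 : 1 ≤ K ^ (4 * c + 1) := one_le_pow₀ hK1
  have h6 : y * K ^ c ≤ 1 * K ^ (4 * c + 1) := by
    have : 0 ≤ K ^ c := by positivity
    exact mul_le_mul (hyq.trans hq1) h4 this zero_le_one
  have h7 : (Zc c : ℝ) ≤ Zc c * K ^ (4 * c + 1) := le_mul_of_one_le_right (by positivity) h5
  gcongr
  linarith
theorem exists_least_nat (P : ℕ → Prop) (h : ∃ t, P t) : ∃ t, P t ∧ ∀ m, m < t → ¬ P m := by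
  haveI : DecidablePred P := Classical.decPred P
  exact ⟨Nat.find h, Nat.find_spec h, fun m hm => Nat.find_min h hm⟩

/-- The event that `x` lies in a subset of `S` without unique output characters. -/
def BX {s c : ℕ} (S : Finset (Fin c → Bits s)) (x : Fin c → Bits s)
    (R : Bool × Fin c × Bits s → Bits s) : Prop :=
  ∃ X ⊆ S, x ∈ X ∧ ∀ y ∈ X, ∀ b : Bool, ∃ z ∈ X, z ≠ y ∧
    simpleTab (fun i a => R (b, i, a)) z = simpleTab (fun i a => R (b, i, a)) y

theorem walk_exists {s c : ℕ} (hc : 1 ≤ c) (S : Finset (Fin c → Bits s)) (x : Fin c → Bits s)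
    (R : Bool × Fin c × Bits s → Bits s) (h : BX S x R) :
    ∃ k ∈ Finset.range (Fintype.card (Fin c → Bits s) + 1), ∃ u ∈ Wk (k + 1) S x, Ev u R := by
  obtain ⟨X, hXS, hxX, hX⟩ := h
  have hch : ∀ (b : Bool) (y : Fin c → Bits s), ∃ z, y ∈ X → z ∈ X ∧ z ≠ y ∧
      simpleTab (fun i a => R (b, i, a)) z = simpleTab (fun i a => R (b, i, a)) y := by
    intro b y
    by_cases hy : y ∈ X
    · obtain ⟨z, hz, h⟩ := hX y hy b
      exact ⟨z, fun _ => ⟨hz, h⟩⟩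
    · exact ⟨y, fun h => absurd h hy⟩
  choose nxt hnxt using hch
  let w : ℕ → Fin c → Bits s := fun t => Nat.rec x (fun t y => nxt (decide (t % 2 = 1)) y) t
  have hw0 : w 0 = x := rfl
  have hws : ∀ t, w (t + 1) = nxt (decide (t % 2 = 1)) (w t) := fun t => rfl
  have hwX : ∀ t, w t ∈ X := by
    intro t
    induction t with
    | zero => exact hxX
    | succ t ih => rw [hws]; exact (hnxt _ _ ih).1
  have hex : ∃ t, t ≤ Fintype.card (Fin c → Bits s) ∧ ∀ i, ∃ j < t, w j i = w t i := by
    obtain ⟨a, b, hab, hwab⟩ := Fintype.exists_ne_map_eq_of_card_lt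
      (fun t : Fin (Fintype.card (Fin c → Bits s) + 1) => w t) (by simp only [Fintype.card_fin]; omega)
    rcases lt_or_gt_of_ne hab with h | h
    · exact ⟨b, by omega, fun i => ⟨a, h, congrFun hwab i⟩⟩
    · exact ⟨a, by omega, fun i => ⟨b, h, congrFun hwab.symm i⟩⟩
  obtain ⟨t0, hspec, hmin⟩ := exists_least_nat _ hex
  have ht0 : t0 ≠ 0 := by
    rintro rfl
    obtain ⟨j, hj, _⟩ := hspec.2 ⟨0, hc⟩
    omega
  have ht1 : t0 ≠ 1 := by
    rintro rfl
    have h1 : w 1 = w 0 := by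
      ext1 i
      obtain ⟨j, hj, h⟩ := hspec.2 i
      have : j = 0 := by omega
      rw [← h, this]
    exact (hnxt _ _ (hwX 0)).2.1 h1
  obtain ⟨k, rfl⟩ : ∃ k, t0 = k + 2 := ⟨t0 - 2, by omega⟩
  refine ⟨k, by simp only [Finset.mem_range]; omega, fun p => w p.val, ?_, ?_⟩
  · rw [mem_Wk]
    refine ⟨hw0, fun p => hXS (hwX _), ?_, ?_, ?_⟩
    · intro p _ hpl
      have hp : p.val < k + 2 := by
        have := p.isLt
        have : p.val ≠ k + 2 := fun h => hpl (Fin.ext h)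
        omega
      have := hmin p.val hp
      have h2 : ¬ ∀ i, ∃ j < p.val, w j i = w p.val i := fun h => this ⟨by omega, h⟩
      push Not at h2
      obtain ⟨i, hi⟩ := h2
      exact ⟨i, fun q hq => hi q.val hq⟩
    · intro i
      obtain ⟨j, hj, h⟩ := hspec.2 i
      refine ⟨⟨j, by omega⟩, ?_, h⟩
      intro h'
      have := congrArg Fin.val h'
      simp only [Fin.val_last] at this
      omega
    · intro t
      exact ((hnxt _ _ (hwX t.val)).2.1).symm
  · intro t
    exact ((hnxt (decide (t.val % 2 = 1)) _ (hwX t.val)).2.2).symm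

theorem summable_term (c : ℕ) (q : ℝ) (hq0 : 0 < q) (hq1 : q < 1) :
    Summable (fun k : ℕ => (2 + Zc c) * ((k + 3 : ℕ) : ℝ) ^ (4 * c + 1) * q ^ k) := by
  have h1 : Summable (fun k : ℕ => (k : ℝ) ^ (4 * c + 1) * q ^ k) :=
    summable_pow_mul_geometric_of_norm_lt_one _ (by rw [Real.norm_of_nonneg hq0.le]; exact hq1)
  have h2 := ((summable_nat_add_iff 3).mpr h1).mul_left ((2 + Zc c) / q ^ 3)
  refine h2.congr fun k => ?_
  rw [pow_add]
  field_simp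
  ring

theorem pr_BX {s c : ℕ} (hc : 1 ≤ c) (S : Finset (Fin c → Bits s)) (x : Fin c → Bits s) (m : ℕ)
    (hm : S.card ≤ m) (hdeg : z4deg S x ≤ Zc c * m) (q : ℝ) (hq1 : q < 1) (hq0 : 0 < q)
    (hmq : (m : ℝ) ≤ q * 2 ^ s) :
    Pr (BX S x) ≤ (1 / 2 ^ s) *
      ∑' k : ℕ, (2 + Zc c) * ((k + 3 : ℕ) : ℝ) ^ (4 * c + 1) * q ^ k := by
  refine (pr_mono (fun R hR => walk_exists hc S x R hR)).trans ?_
  refine (pr_union _ (fun k R => ∃ u ∈ Wk (k + 1) S x, Ev u R)).trans ?_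
  refine (Finset.sum_le_sum fun k _ => pr_walk S x m hm hdeg q hq1.le hq0.le hmq).trans ?_
  rw [← Finset.mul_sum]
  refine mul_le_mul_of_nonneg_left ?_ (by positivity)
  exact (summable_term c q hq0 hq1).sum_le_tsum _ (fun k _ => by positivity)

/-- Double tabulation is fully random on any given not-too-large set
(Theorem 8): for constants `c, d ≥ 1` and `δ > 0` there is a constant `C` such that for
any set `S ⊆ Σ^c` of at most `(1−δ)|Σ|` keys and independent random simple tabulation
functions `h₀ : Σ^c → Σ^d`, `h₁ : Σ^d → [2^r]`: with probability at least
`1 − C·|Σ|^{1−⌊d/2⌋}` every nonempty `X ⊆ S` has a unique output character under `h₀`;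
and conditioned on any fixed outcome `T₀` of `h₀` with this property, the restriction
of `h₁ ∘ h₀` to `S` is fully random (the values on `S` are independent, each uniform in
`[2^r]`; equivalently, each assignment `g` of values to `S` appears with probability
`(1/2^r)^{|S|}`). -/
theorem double_tabulation_fully_random_on_a_set
    (c d : ℕ) (hc : 1 ≤ c) (hd : 1 ≤ d) (δ : ℝ) (hδ : 0 < δ) :
    ∃ C : ℝ,
      ∀ (s r : ℕ) (S : Finset (Fin c → Bits s)),
        (S.card : ℝ) ≤ (1 - δ) * (2 : ℝ) ^ s →
        (1 - C * ((2 : ℝ) ^ s) ^ ((1 : ℝ) - ((d / 2 : ℕ) : ℝ)) ≤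
          Pr (fun T₀ : Fin c → Bits s → (Fin d → Bits s) =>
            ∀ X ⊆ S, X.Nonempty → UniqueOutputChar (fun y => simpleTab T₀ y) X)) ∧
        ∀ T₀ : Fin c → Bits s → (Fin d → Bits s),
          (∀ X ⊆ S, X.Nonempty → UniqueOutputChar (fun y => simpleTab T₀ y) X) →
          ∀ g : (Fin c → Bits s) → Bits r,
            Pr (fun T₁ : Fin d → Bits s → Bits r =>
                ∀ x ∈ S, simpleTab T₁ (simpleTab T₀ x) = g x) =
              (1 / 2 ^ r) ^ S.card := by
  set q : ℝ := max (1 - δ) (1 / 2) with hq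
  have hq0 : 0 < q := lt_of_lt_of_le (by norm_num) (le_max_right _ _)
  have hq1 : q < 1 := max_lt (by linarith) (by norm_num)
  have hsum := summable_term c q hq0 hq1
  set K : ℝ := ∑' k : ℕ, (2 + Zc c) * ((k + 3 : ℕ) : ℝ) ^ (4 * c + 1) * q ^ k with hK
  have hK0 : 0 ≤ K := tsum_nonneg fun k => by positivity
  refine ⟨K ^ (d / 2), fun s r S hS => ⟨?_, ?_⟩⟩
  swap
  · intro T₀ hT g
    exact part_two d s r S (fun y => simpleTab T₀ y) hT g
  set n : ℝ := 2 ^ s with hn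
  have hn0 : 0 < n := by positivity
  have hSq : (S.card : ℝ) ≤ q * n := hS.trans (by
    gcongr; exact le_max_left _ _)
  obtain ⟨Dm, hD1, hD2⟩ := degen S
  let idx : Fin (d / 2) → Bool → Fin d := fun i b => ⟨2 * i.val + b.toNat, by
    have := i.isLt
    have := b.toNat_le
    omega⟩
  let φ : (Fin c → Bits s → (Fin d → Bits s)) →+
      (Fin (d / 2) → (Bool × Fin c × Bits s → Bits s)) :=
    { toFun := fun T i w => T w.2.1 w.2.2 (idx i w.1)
      map_zero' := rfl
      map_add' := fun _ _ => rfl }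
  have hφ : Function.Surjective φ := by
    intro f
    refine ⟨fun a l j => if h : j.val / 2 < d / 2 then
      f ⟨j.val / 2, h⟩ (decide (j.val % 2 = 1), a, l) else 0, ?_⟩
    ext1 i
    ext1 ⟨b, a, l⟩
    have h1 : (2 * i.val + b.toNat) / 2 = i.val := by
      have := b.toNat_le
      cases b <;> simp <;> omega
    have h2 : decide ((2 * i.val + b.toNat) % 2 = 1) = b := by
      cases b <;> simp <;> omega
    show (if h : (2 * i.val + b.toNat) / 2 < d / 2 then
      f ⟨(2 * i.val + b.toNat) / 2, h⟩ (decide ((2 * i.val + b.toNat) % 2 = 1), a, l) else 0) = _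
    simp only [h2, h1, i.isLt, dif_pos]
  rw [pr_not]
  have hbad : Pr (fun T₀ : Fin c → Bits s → (Fin d → Bits s) =>
      ¬ ∀ X ⊆ S, X.Nonempty → UniqueOutputChar (fun y => simpleTab T₀ y) X) ≤
      Pr (fun T₀ => ∃ x ∈ S, ∀ i, BX (Dm x) x (φ T₀ i)) := by
    refine pr_mono fun T hT => ?_
    push Not at hT
    obtain ⟨X, hXS, hXne, hX⟩ := hT
    obtain ⟨x, hx, hXD⟩ := hD2 X hXS hXne
    refine ⟨x, hXS hx, fun i => ⟨X, hXD, hx, fun y hy b => ?_⟩⟩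
    by_contra hcon
    push Not at hcon
    apply hX
    refine ⟨y, hy, idx i b, fun z hz hzy heq => hcon z hz hzy ?_⟩
    simpa [simpleTab, Finset.sum_apply, φ] using heq
  have hfin : Pr (fun T₀ => ∃ x ∈ S, ∀ i, BX (Dm x) x (φ T₀ i)) ≤ n * (1 / n * K) ^ (d / 2) := by
    refine (pr_union S (fun x T₀ => ∀ i, BX (Dm x) x (φ T₀ i))).trans ?_
    have h1 : ∀ x ∈ S, Pr (fun T₀ => ∀ i, BX (Dm x) x (φ T₀ i)) ≤ (1 / n * K) ^ (d / 2) := by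
      intro x hx
      have h2 := pr_hom φ hφ (fun f => ∀ i, BX (Dm x) x (f i))
      rw [h2, pr_pi, Fintype.card_fin]
      refine pow_le_pow_left₀ (pr_nonneg _) ?_ _
      exact pr_BX hc (Dm x) x S.card (Finset.card_le_card (hD1 x hx).2.1) (hD1 x hx).2.2 q hq1 hq0
        hSq
    refine (Finset.sum_le_card_nsmul _ _ _ h1).trans ?_
    rw [nsmul_eq_mul]
    refine mul_le_mul_of_nonneg_right ?_ (by positivity)
    refine hSq.trans ?_
    nlinarith
  have e : n * (1 / n * K) ^ (d / 2) = K ^ (d / 2) * n ^ ((1 : ℝ) - ((d / 2 : ℕ) : ℝ)) := by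
    rw [Real.rpow_sub hn0, Real.rpow_one, Real.rpow_natCast, mul_pow, one_div, inv_pow]
    field_simp
  rw [e] at hfin
  linarith [hbad.trans hfin]
end
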